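/- The following are equivalent: (1) there exists an existentially closed K_{2,2}-free incidence structure M such that for every existentially closed K_{2,2}-free incidence structure N there is an elementary embedding of M into N; (2) every finite partial plane embeds as an induced substructure into a finite projective plane. -/

import Mathlib

open FirstOrder FirstOrder.Language

universe u v

/-- Relation symbols of the language of incidence structures: two unary symbols
(`pt` for "point", `lin` for "line") and one binary symbol (`inc` for "incidence"). -/
inductive IncRel : ℕ → Type
  | pt : IncRel 1
  | lin : IncRel 1
  | inc : IncRel 2

/-- The first-order language `{P, L, I}` of incidence structures. -/
def IncLang : FirstOrder.Language := ⟨fun _ => Empty, IncRel⟩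

section
variable {M : Type u} [IncLang.Structure M]

/-- `x` is a point. -/
def ptL (x : M) : Prop := Structure.RelMap (L := IncLang) IncRel.pt ![x]

/-- `x` is a line. -/
def lnL (x : M) : Prop := Structure.RelMap (L := IncLang) IncRel.lin ![x]

/-- `x` is incident to `y`. -/
def incL (x y : M) : Prop := Structure.RelMap (L := IncLang) IncRel.inc ![x, y]

end

/-- `M` is an incidence structure: points and lines partition the domain, and
incidence only holds between a point and a line. -/
def IsIncidenceL (M : Type u) [IncLang.Structure M] : Prop :=
  (∀ x : M, ptL x ∨ lnL x) ∧ (∀ x : M, ¬(ptL x ∧ lnL x)) ∧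
    ∀ x y : M, incL x y → ptL x ∧ lnL y

/-- `M` is `K_{m,n}`-free: there are no `m` pairwise distinct points and `n` pairwise
distinct lines with every one of the points incident to every one of the lines. -/
def KFreeL (m n : ℕ) (M : Type u) [IncLang.Structure M] : Prop :=
  ¬∃ (a : Fin m → M) (b : Fin n → M),
      Function.Injective a ∧ Function.Injective b ∧
      (∀ i, ptL (a i)) ∧ (∀ j, lnL (b j)) ∧ ∀ i j, incL (a i) (b j)

/-- `M` is an existentially closed `K_{m,n}`-free incidence structure: `M` is a
`K_{m,n}`-free incidence structure, and for every `K_{m,n}`-free incidence structure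
`N` containing `M` as an induced substructure (i.e. admitting an embedding of `M`),
every existential formula `∃ ȳ φ(ā, ȳ)` (with `φ` quantifier-free and parameters `ā`
from `M`) that holds in `N` also holds in `M`. -/
def IsECL (m n : ℕ) (M : Type u) [IncLang.Structure M] : Prop :=
  IsIncidenceL M ∧ KFreeL m n M ∧
    ∀ (N : Type u) [IncLang.Structure N], IsIncidenceL N → KFreeL m n N →
      ∀ (f : M ↪[IncLang] N) (k : ℕ) (φ : IncLang.BoundedFormula M k), φ.IsQF →
        (∃ xs : Fin k → N, φ.Realize (f : M → N) xs) →
          ∃ xs : Fin k → M, φ.Realize (id : M → M) xs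

/-- A projective plane: a `K_{2,2}`-free incidence structure in which any two distinct
points are both incident to exactly one common line and any two distinct lines are both
incident to exactly one common point. -/
def IsProjPlaneL (M : Type u) [IncLang.Structure M] : Prop :=
  IsIncidenceL M ∧ KFreeL 2 2 M ∧
  (∀ x y : M, ptL x → ptL y → x ≠ y → ∃! z : M, incL x z ∧ incL y z) ∧
  (∀ x y : M, lnL x → lnL y → x ≠ y → ∃! z : M, incL z x ∧ incL z y)



/-- A partial plane, presented combinatorially; a line is a non-point. -/
structure Geo (X : Type*) where
  pt : X → Prop
  inc : X → X → Prop
  inc_pt : ∀ x y, inc x y → pt x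
  inc_ln : ∀ x y, inc x y → ¬ pt y
  k22 : ∀ p q l m, inc p l → inc q l → inc p m → inc q m → p = q ∨ l = m

/-- `g` restricts to an embedding on the set `T`. -/
structure PEmb {X Y : Type*} (G : Geo X) (H : Geo Y) (T : Set X) (g : X → Y) : Prop where
  inj : ∀ x ∈ T, ∀ y ∈ T, g x = g y → x = y
  pt : ∀ x ∈ T, (H.pt (g x) ↔ G.pt x)
  inc : ∀ x ∈ T, ∀ y ∈ T, (H.inc (g x) (g y) ↔ G.inc x y)

theorem PEmb.mono {X Y : Type*} {G : Geo X} {H : Geo Y} {S T : Set X} {g : X → Y}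
    (h : PEmb G H T g) (hS : S ⊆ T) : PEmb G H S g :=
  ⟨fun x hx y hy => h.inj x (hS hx) y (hS hy), fun x hx => h.pt x (hS hx),
    fun x hx y hy => h.inc x (hS hx) y (hS hy)⟩

theorem PEmb.congr {X Y : Type*} {G : Geo X} {H : Geo Y} {T : Set X} {g g' : X → Y}
    (h : PEmb G H T g) (hS : ∀ x ∈ T, g' x = g x) : PEmb G H T g' := by
  refine ⟨fun x hx y hy => ?_, fun x hx => ?_, fun x hx y hy => ?_⟩
  · rw [hS x hx, hS y hy]; exact h.inj x hx y hy
  · rw [hS x hx]; exact h.pt x hx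
  · rw [hS x hx, hS y hy]; exact h.inc x hx y hy

theorem PEmb.comp {X Y Z : Type*} {G : Geo X} {H : Geo Y} {K : Geo Z} {T : Set X} {S : Set Y}
    {g : X → Y} {f : Y → Z}
    (hf : PEmb H K S f) (hg : PEmb G H T g) (hS : ∀ x ∈ T, g x ∈ S) :
    PEmb G K T (fun x => f (g x)) := by
  refine ⟨fun x hx y hy h => ?_, fun x hx => ?_, fun x hx y hy => ?_⟩
  · exact hg.inj x hx y hy (hf.inj _ (hS x hx) _ (hS y hy) h)
  · rw [hf.pt _ (hS x hx), hg.pt x hx]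
  · rw [hf.inc _ (hS x hx) _ (hS y hy), hg.inc x hx y hy]

/-- Total embedding. -/
def Emb {X Y : Type*} (G : Geo X) (H : Geo Y) (g : X → Y) : Prop := PEmb G H Set.univ g

/-- Existential closedness, in terms of finite configurations. -/
def EC {N : Type u} (G : Geo N) : Prop :=
  ∀ (Y : Type u) (H : Geo Y) (f : N → Y), Emb G H f → ∀ T : Set Y, T.Finite →
    ∃ g : Y → N, PEmb H G T g ∧ ∀ s, f s ∈ T → g (f s) = s

/-- Projective plane. -/
def Plane {N : Type*} (G : Geo N) : Prop :=
  (∀ x y, G.pt x → G.pt y → x ≠ y → ∃ z, G.inc x z ∧ G.inc y z) ∧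
  (∀ x y, ¬ G.pt x → ¬ G.pt y → x ≠ y → ∃ z, G.inc z x ∧ G.inc z y)

/-- Free amalgam. -/
def amalg {N C : Type u} (G : Geo N) (K : Geo C) (E D : Set C) (h : C → N)
    (hD : D ⊆ E) (hh : PEmb K G D h)
    (H1 : ∀ p ∈ D, ∀ q ∈ D, p ≠ q → ∀ l ∈ E, l ∉ D → K.inc p l → K.inc q l →
      ∀ m, G.inc (h p) m → G.inc (h q) m → False)
    (H2 : ∀ p ∈ D, ∀ q ∈ D, p ≠ q → ∀ l ∈ E, l ∉ D → K.inc l p → K.inc l q →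
      ∀ m, G.inc m (h p) → G.inc m (h q) → False) :
    Geo (N ⊕ {x : C // x ∈ E ∧ x ∉ D}) where
  pt := Sum.elim G.pt (fun x => K.pt x)
  inc := fun x y => match x, y with
    | .inl a, .inl b => G.inc a b
    | .inl a, .inr y => ∃ d ∈ D, h d = a ∧ K.inc d y
    | .inr x, .inl b => ∃ d ∈ D, h d = b ∧ K.inc x d
    | .inr x, .inr y => K.inc x y
  inc_pt := by
    rintro (a|x) (b|y) h1
    · exact G.inc_pt _ _ h1
    · obtain ⟨d, hd, rfl, h2⟩ := h1
      exact (hh.pt d hd).2 (K.inc_pt _ _ h2)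
    · obtain ⟨d, hd, rfl, h2⟩ := h1
      exact (K.inc_pt _ _ h2)
    · exact K.inc_pt _ _ h1
  inc_ln := by
    rintro (a|x) (b|y) h1
    · exact G.inc_ln _ _ h1
    · obtain ⟨d, hd, rfl, h2⟩ := h1
      exact (K.inc_ln _ _ h2)
    · obtain ⟨d, hd, rfl, h2⟩ := h1
      exact fun h3 => (K.inc_ln _ _ h2) ((hh.pt d hd).1 h3)
    · exact K.inc_ln _ _ h1
  k22 := by
    have e1 := K.k22
    have e3 := hh.inj
    have e4 := fun x hx y hy => (hh.inc x hx y hy).1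
    rintro (p|⟨p, hp⟩) (q|⟨q, hq⟩) (l|⟨l, hl⟩) (m|⟨m, hm⟩) a1 a2 a3 a4 <;>
      simp only [Sum.inl.injEq, Sum.inr.injEq, reduceCtorEq, or_false, false_or,
        Subtype.mk.injEq] at *
    · exact G.k22 _ _ _ _ a1 a2 a3 a4
    · obtain ⟨d1, b1, rfl, c1⟩ := a3
      obtain ⟨d2, b2, rfl, c2⟩ := a4
      by_contra hne
      exact H1 d1 b1 d2 b2 (fun h => hne (h ▸ rfl)) m hm.1 hm.2 c1 c2 l a1 a2
    · obtain ⟨d1, b1, rfl, c1⟩ := a1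
      obtain ⟨d2, b2, rfl, c2⟩ := a2
      by_contra hne
      exact H1 d1 b1 d2 b2 (fun h => hne (h ▸ rfl)) l hl.1 hl.2 c1 c2 m a3 a4
    · obtain ⟨d1, b1, rfl, c1⟩ := a1
      obtain ⟨d2, b2, rfl, c2⟩ := a2
      obtain ⟨d3, b3, f3, c3⟩ := a3
      obtain ⟨d4, b4, f4, c4⟩ := a4
      obtain rfl := e3 _ b3 _ b1 f3
      obtain rfl := e3 _ b4 _ b2 f4
      exact (e1 _ _ _ _ c1 c2 c3 c4).imp_left (congrArg h)
    · obtain ⟨d1, b1, rfl, c1⟩ := a2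
      obtain ⟨d2, b2, rfl, c2⟩ := a4
      by_contra hne
      exact H2 d1 b1 d2 b2 (fun h => hne (h ▸ rfl)) q hq.1 hq.2 c1 c2 p a1 a3
    · obtain ⟨d1, b1, rfl, c1⟩ := a2
      obtain ⟨d2, b2, rfl, c2⟩ := a3
      rcases e1 _ _ _ _ (e4 _ b2 _ b1 a1) c1 c2 a4 with rfl | rfl
      · exact hq.2 b2
      · exact hm.2 b1
    · obtain ⟨d1, b1, rfl, c1⟩ := a1
      obtain ⟨d2, b2, rfl, c2⟩ := a4
      rcases e1 _ _ _ _ (e4 _ b1 _ b2 a3) c2 c1 a2 with rfl | rfl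
      · exact hq.2 b1
      · exact hl.2 b2
    · obtain ⟨d1, b1, rfl, c1⟩ := a1
      obtain ⟨d2, b2, f2, c2⟩ := a3
      obtain rfl := e3 _ b2 _ b1 f2
      rcases e1 _ _ _ _ c1 a2 c2 a4 with rfl | rfl
      · exact absurd b1 hq.2
      · rfl
    · obtain ⟨d1, b1, rfl, c1⟩ := a1
      obtain ⟨d2, b2, rfl, c2⟩ := a3
      by_contra hne
      exact H2 d1 b1 d2 b2 (fun h => hne (h ▸ rfl)) p hp.1 hp.2 c1 c2 q a2 a4
    · obtain ⟨d1, b1, rfl, c1⟩ := a1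
      obtain ⟨d2, b2, rfl, c2⟩ := a4
      rcases e1 _ _ _ _ c1 (e4 _ b2 _ b1 a2) a3 c2 with rfl | rfl
      · exact hp.2 b2
      · exact hm.2 b1
    · obtain ⟨d1, b1, rfl, c1⟩ := a2
      obtain ⟨d2, b2, rfl, c2⟩ := a3
      rcases e1 _ _ _ _ a1 c1 c2 (e4 _ b1 _ b2 a4) with rfl | rfl
      · exact hp.2 b1
      · exact hl.2 b2
    · obtain ⟨d1, b1, rfl, c1⟩ := a2
      obtain ⟨d2, b2, f2, c2⟩ := a4
      obtain rfl := e3 _ b2 _ b1 f2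
      rcases e1 _ _ _ _ a1 c1 a3 c2 with rfl | rfl
      · exact absurd b1 hp.2
      · rfl
    · obtain ⟨d1, b1, rfl, c1⟩ := a1
      obtain ⟨d2, b2, f2, c2⟩ := a2
      obtain ⟨d3, b3, rfl, c3⟩ := a3
      obtain ⟨d4, b4, f4, c4⟩ := a4
      obtain rfl := e3 _ b2 _ b1 f2
      obtain rfl := e3 _ b4 _ b3 f4
      exact (e1 _ _ _ _ c1 c2 c3 c4).imp_right (congrArg h)
    · obtain ⟨d1, b1, rfl, c1⟩ := a1
      obtain ⟨d2, b2, f2, c2⟩ := a2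
      obtain rfl := e3 _ b2 _ b1 f2
      rcases e1 _ _ _ _ c1 c2 a3 a4 with rfl | rfl
      · rfl
      · exact absurd b1 hm.2
    · obtain ⟨d1, b1, rfl, c1⟩ := a3
      obtain ⟨d2, b2, f2, c2⟩ := a4
      obtain rfl := e3 _ b2 _ b1 f2
      rcases e1 _ _ _ _ a1 a2 c1 c2 with rfl | rfl
      · rfl
      · exact absurd b1 hl.2
    · exact e1 _ _ _ _ a1 a2 a3 a4

theorem EC.extend {N C : Type u} {G : Geo N} (hG : EC G) (K : Geo C) (E D : Set C) (h : C → N)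
    (hE : E.Finite) (hD : D ⊆ E) (hh : PEmb K G D h)
    (H1 : ∀ p ∈ D, ∀ q ∈ D, p ≠ q → ∀ l ∈ E, l ∉ D → K.inc p l → K.inc q l →
      ∀ m, G.inc (h p) m → G.inc (h q) m → False)
    (H2 : ∀ p ∈ D, ∀ q ∈ D, p ≠ q → ∀ l ∈ E, l ∉ D → K.inc l p → K.inc l q →
      ∀ m, G.inc m (h p) → G.inc m (h q) → False) :
    ∃ g : C → N, PEmb K G E g ∧ ∀ x ∈ D, g x = h x := by
  classical
  let A := amalg G K E D h hD hh H1 H2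
  let ι : C → N ⊕ {x : C // x ∈ E ∧ x ∉ D} := fun x =>
    if hx : x ∈ E ∧ x ∉ D then .inr ⟨x, hx⟩ else .inl (h x)
  have hι : PEmb K A E ι := by
    have e3 := hh.inj
    have e4 := hh.inc
    have e5 := hh.pt
    refine ⟨fun x hx y hy hxy => ?_, fun x hx => ?_, fun x hx y hy => ?_⟩
    · by_cases h1 : x ∈ D <;> by_cases h2 : y ∈ D <;> simp_all [ι]
      exact e3 x h1 y h2 hxy
    · by_cases h1 : x ∈ D <;> simp_all [ι, A, amalg]
    · by_cases h1 : x ∈ D <;> by_cases h2 : y ∈ D <;> simp_all [ι, A, amalg] <;> grind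
  obtain ⟨g, hg1, hg2⟩ := hG _ A Sum.inl
    ⟨fun x _ y _ h => Sum.inl_injective h, fun x _ => Iff.rfl, fun x _ y _ => Iff.rfl⟩
    (ι '' E) (hE.image _)
  refine ⟨fun x => g (ι x), hg1.comp hι (fun x hx => ⟨x, hx, rfl⟩), fun x hx => ?_⟩
  have : ι x = .inl (h x) := by simp [ι, hx]
  simp only [this]
  apply hg2
  exact ⟨x, hD hx, this⟩

/-- Adding a new element `v` (a point iff `b`), incident to exactly the elements of `S`. -/
def addElem {X : Type*} (G : Geo X) (v : X) (b : Prop) (S : Set X)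
    (hv1 : ∀ x, ¬ G.inc x v) (hv2 : ∀ x, ¬ G.inc v x) (hvS : v ∉ S)
    (hS : ∀ x ∈ S, (G.pt x ↔ ¬ b))
    (hS1 : ∀ x ∈ S, ∀ y ∈ S, x ≠ y → ∀ z, G.inc x z → G.inc y z → False)
    (hS2 : ∀ x ∈ S, ∀ y ∈ S, x ≠ y → ∀ z, G.inc z x → G.inc z y → False) : Geo X where
  pt := fun x => (x = v ∧ b) ∨ (x ≠ v ∧ G.pt x)
  inc := fun x y => G.inc x y ∨ (b ∧ x = v ∧ y ∈ S) ∨ (¬ b ∧ y = v ∧ x ∈ S)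
  inc_pt := by
    intro x y h
    have := G.inc_pt x y
    grind
  inc_ln := by
    intro x y h
    have := G.inc_ln x y
    grind
  k22 := by
    intro p q l m h1 h2 h3 h4
    have := G.k22 p q l m
    grind

theorem EC.plane {N : Type u} {G : Geo N} (hG : EC G) : Plane G := by
  let G0 : Geo (Option N) :=
    { pt := fun x => ∃ y, x = some y ∧ G.pt y
      inc := fun x y => ∃ a b, x = some a ∧ y = some b ∧ G.inc a b
      inc_pt := by have := G.inc_pt; grind
      inc_ln := by have := G.inc_ln; grind
      k22 := by have := G.k22; grind }
  constructor
  · intro x y hx hy hxy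
    by_contra hcon
    push Not at hcon
    let G1 := addElem G0 none False {some x, some y} (by simp [G0]) (by simp [G0]) (by simp)
      (by simp [G0, hx, hy]) (by simp only [G0]; grind) (by
        have := G.inc_ln
        simp only [G0]; grind)
    obtain ⟨g, hg1, hg2⟩ := hG _ G1 some
      ⟨fun x _ y _ h => Option.some_injective _ h, fun x _ => by simp [G1, addElem, G0],
        fun x _ y _ => by simp [G1, addElem, G0]⟩
      {none, some x, some y} (by simp)
    have a1 := (hg1.inc (some x) (by simp) none (by simp)).2 (by simp [G1, addElem])
    have a2 := (hg1.inc (some y) (by simp) none (by simp)).2 (by simp [G1, addElem])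
    rw [hg2 _ (by simp)] at a1 a2
    exact hcon _ a1 a2
  · intro x y hx hy hxy
    by_contra hcon
    push Not at hcon
    let G1 := addElem G0 none True {some x, some y} (by simp [G0]) (by simp [G0]) (by simp)
      (by simp [G0, hx, hy]) (by
        have := G.inc_pt
        simp only [G0]; grind) (by simp only [G0]; grind)
    obtain ⟨g, hg1, hg2⟩ := hG _ G1 some
      ⟨fun x _ y _ h => Option.some_injective _ h, fun x _ => by simp [G1, addElem, G0],
        fun x _ y _ => by simp [G1, addElem, G0]⟩
      {none, some x, some y} (by simp)
    have a1 := (hg1.inc none (by simp) (some x) (by simp)).2 (by simp [G1, addElem])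
    have a2 := (hg1.inc none (by simp) (some y) (by simp)).2 (by simp [G1, addElem])
    rw [hg2 _ (by simp)] at a1 a2
    exact hcon _ a1 a2

open Classical in
/-- Join or meet of two elements (with a default value). -/
noncomputable def Geo.op {X : Type*} (G : Geo X) (x y : X) : X :=
  if h : ∃ z, x ≠ y ∧ ((G.inc x z ∧ G.inc y z) ∨ (G.inc z x ∧ G.inc z y)) then h.choose else x

theorem Geo.op_eq {X : Type*} (G : Geo X) {x y z : X} (hxy : x ≠ y)
    (h : (G.inc x z ∧ G.inc y z) ∨ (G.inc z x ∧ G.inc z y)) : G.op x y = z := by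
  have h' : ∃ z, x ≠ y ∧ ((G.inc x z ∧ G.inc y z) ∨ (G.inc z x ∧ G.inc z y)) := ⟨z, hxy, h⟩
  rw [Geo.op, dif_pos h']
  have := h'.choose_spec
  generalize h'.choose = w at *
  have e1 := G.k22
  have e2 := G.inc_pt
  have e3 := G.inc_ln
  grind

theorem Geo.op_self {X : Type*} (G : Geo X) (x : X) : G.op x x = x := by
  simp [Geo.op]

theorem Geo.op_mixed {X : Type*} (G : Geo X) (x y : X) (h : ¬ (G.pt x ↔ G.pt y)) :
    G.op x y = x := by
  rw [Geo.op, dif_neg]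
  have e2 := G.inc_pt
  have e3 := G.inc_ln
  grind

theorem Geo.op_map {X Y : Type*} {G : Geo X} {H : Geo Y} (hG : Plane G) {T : Set X} {g : X → Y}
    (hg : PEmb G H T g) {x y : X} (hx : x ∈ T) (hy : y ∈ T) (hxy : G.op x y ∈ T) :
    H.op (g x) (g y) = g (G.op x y) := by
  by_cases h : x = y
  · subst h; simp [Geo.op_self]
  by_cases h1 : (G.pt x ↔ G.pt y)
  · have hne : g x ≠ g y := fun h' => h (hg.inj x hx y hy h')
    apply Geo.op_eq _ hne
    by_cases h2 : G.pt x
    · obtain ⟨z, hz⟩ := hG.1 x y h2 (h1.1 h2) h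
      have : G.op x y = z := G.op_eq h (Or.inl hz)
      rw [this] at hxy ⊢
      left
      exact ⟨(hg.inc _ hx _ hxy).2 hz.1, (hg.inc _ hy _ hxy).2 hz.2⟩
    · obtain ⟨z, hz⟩ := hG.2 x y h2 (fun h3 => h2 (h1.2 h3)) h
      have : G.op x y = z := G.op_eq h (Or.inr hz)
      rw [this] at hxy ⊢
      right
      exact ⟨(hg.inc _ hxy _ hx).2 hz.1, (hg.inc _ hxy _ hy).2 hz.2⟩
  · rw [Geo.op_mixed _ _ _ h1, Geo.op_mixed]
    rwa [hg.pt x hx, hg.pt y hy]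


/-- The combinatorial presentation of a partial plane. -/
def toGeo {M : Type*} [IncLang.Structure M] (h1 : IsIncidenceL M) (h2 : KFreeL 2 2 M) : Geo M where
  pt := ptL
  inc := incL
  inc_pt := fun x y h => (h1.2.2 x y h).1
  inc_ln := fun x y h h' => h1.2.1 y ⟨h', (h1.2.2 x y h).2⟩
  k22 := by
    intro p q l m a1 a2 a3 a4
    by_contra hcon
    push Not at hcon
    refine h2 ⟨![p, q], ![l, m], ?_, ?_, ?_, ?_, ?_⟩
    · intro i j; fin_cases i <;> fin_cases j <;> simp [hcon.1, hcon.1.symm]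
    · intro i j; fin_cases i <;> fin_cases j <;> simp [hcon.2, hcon.2.symm]
    · intro i; fin_cases i
      · exact (h1.2.2 _ _ a1).1
      · exact (h1.2.2 _ _ a2).1
    · intro i; fin_cases i
      · exact (h1.2.2 _ _ a1).2
      · exact (h1.2.2 _ _ a3).2
    · intro i j; fin_cases i <;> fin_cases j <;> simpa

/-- Interpretation of the relation symbols in a `Geo`. -/
def geoRel {X : Type*} (G : Geo X) : {n : ℕ} → IncRel n → (Fin n → X) → Prop
  | _, .pt, xs => G.pt (xs 0)
  | _, .lin, xs => ¬ G.pt (xs 0)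
  | _, .inc, xs => G.inc (xs 0) (xs 1)

/-- The first-order structure attached to a `Geo`. -/
def ofGeo {X : Type*} (G : Geo X) : IncLang.Structure X where
  funMap := fun f _ => Empty.elim f
  RelMap := fun r xs => geoRel G r xs

theorem ofGeo_pt {X : Type*} (G : Geo X) (x : X) : @ptL X (ofGeo G) x ↔ G.pt x := Iff.rfl
theorem ofGeo_ln {X : Type*} (G : Geo X) (x : X) : @lnL X (ofGeo G) x ↔ ¬ G.pt x := Iff.rfl
theorem ofGeo_inc {X : Type*} (G : Geo X) (x y : X) : @incL X (ofGeo G) x y ↔ G.inc x y := Iff.rfl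

theorem ofGeo_inci {X : Type*} (G : Geo X) : @IsIncidenceL X (ofGeo G) :=
  letI := ofGeo G
  ⟨fun x => em (G.pt x), fun x h => h.2 h.1, fun x y h => ⟨G.inc_pt x y h, G.inc_ln x y h⟩⟩

theorem ofGeo_kfree {X : Type*} (G : Geo X) : @KFreeL 2 2 X (ofGeo G) := by
  letI := ofGeo G
  rintro ⟨a, b, ha, hb, -, -, h⟩
  rcases G.k22 (a 0) (a 1) (b 0) (b 1) (h 0 0) (h 1 0) (h 0 1) (h 1 1) with h' | h'
  · exact absurd (ha h') (by simp)
  · exact absurd (hb h') (by simp)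

theorem relMap_iff {M N : Type*} [IncLang.Structure M] [IncLang.Structure N]
    {n : ℕ} (r : IncLang.Relations n) (x : Fin n → M) (y : Fin n → N)
    (h1 : ∀ i, ptL (x i) ↔ ptL (y i)) (h2 : ∀ i, lnL (x i) ↔ lnL (y i))
    (h3 : ∀ i j, incL (x i) (x j) ↔ incL (y i) (y j)) :
    Structure.RelMap r x ↔ Structure.RelMap r y := by
  change IncRel n at r
  cases r with
  | pt =>
    have e1 : x = ![x 0] := by ext i; fin_cases i; rfl
    have e2 : y = ![y 0] := by ext i; fin_cases i; rfl
    rw [e1, e2]; exact h1 0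
  | lin =>
    have e1 : x = ![x 0] := by ext i; fin_cases i; rfl
    have e2 : y = ![y 0] := by ext i; fin_cases i; rfl
    rw [e1, e2]; exact h2 0
  | inc =>
    have e1 : x = ![x 0, x 1] := by ext i; fin_cases i <;> rfl
    have e2 : y = ![y 0, y 1] := by ext i; fin_cases i <;> rfl
    rw [e1, e2]; exact h3 0 1

theorem ln_iff {M : Type*} [IncLang.Structure M] (h : IsIncidenceL M) (x : M) :
    lnL x ↔ ¬ ptL x := by
  have h1 := h.1 x
  have h2 := h.2.1 x
  tauto

/-- Embeddings from combinatorial embeddings. -/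
def mkEmb {M N : Type*} [IncLang.Structure M] [IncLang.Structure N]
    (hM : IsIncidenceL M) (hN : IsIncidenceL N) (f : M → N) (hf : Function.Injective f)
    (h1 : ∀ x, ptL (f x) ↔ ptL x) (h2 : ∀ x y, incL (f x) (f y) ↔ incL x y) : M ↪[IncLang] N where
  toFun := f
  inj' := hf
  map_fun' := fun g => Empty.elim g
  map_rel' := fun r x => relMap_iff r _ _ (fun i => h1 _)
    (fun i => by rw [ln_iff hM, ln_iff hN]; exact not_congr (h1 _)) (fun i j => h2 _ _)

theorem emb_pt {M N : Type*} [IncLang.Structure M] [IncLang.Structure N] (f : M ↪[IncLang] N)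
    (x : M) : ptL (f x) ↔ ptL x := by
  have := f.map_rel' (IncRel.pt : IncLang.Relations 1) ![x]
  have e : (f.toFun ∘ ![x]) = ![f x] := by ext i; fin_cases i; rfl
  rw [e] at this
  exact this

theorem emb_inc {M N : Type*} [IncLang.Structure M] [IncLang.Structure N] (f : M ↪[IncLang] N)
    (x y : M) : incL (f x) (f y) ↔ incL x y := by
  have := f.map_rel' (IncRel.inc : IncLang.Relations 2) ![x, y]
  have e : (f.toFun ∘ ![x, y]) = ![f x, f y] := by ext i; fin_cases i <;> rfl
  rw [e] at this
  exact this

theorem emb_Emb {M N : Type*} [IncLang.Structure M] [IncLang.Structure N] (f : M ↪[IncLang] N)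
    (h1 : IsIncidenceL M) (h2 : KFreeL 2 2 M) (h3 : IsIncidenceL N) (h4 : KFreeL 2 2 N) :
    Emb (toGeo h1 h2) (toGeo h3 h4) f :=
  ⟨fun x _ y _ h => f.injective h, fun x _ => emb_pt f x, fun x _ y _ => emb_inc f x y⟩

/-- Terms are variables. -/
theorem term_var {α : Type*} (t : IncLang.Term α) : ∃ a, t = Term.var a := by
  cases t with
  | var a => exact ⟨a, rfl⟩
  | func f _ => exact Empty.elim f

theorem exists_conj {α : Type*} {k : ℕ} {β : Type} [Finite β] (ψ : β → IncLang.BoundedFormula α k)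
    (h : ∀ b, (ψ b).IsQF) : ∃ φ : IncLang.BoundedFormula α k, φ.IsQF ∧
      ∀ (M : Type u) [IncLang.Structure M] (v : α → M) (xs : Fin k → M),
        φ.Realize v xs ↔ ∀ b, (ψ b).Realize v xs := by
  refine ⟨BoundedFormula.iInf ψ, ?_, fun M _ v xs => BoundedFormula.realize_iInf⟩
  change (List.foldr (· ⊓ ·) ⊤
    (List.map ψ (@Finset.univ β (Fintype.ofFinite β)).toList)).IsQF
  generalize (@Finset.univ β (Fintype.ofFinite β)).toList = L
  induction L with
  | nil => exact BoundedFormula.IsQF.top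
  | cons a L ih => exact (h a).inf ih

theorem exists_lit {α : Type*} {k : ℕ} (ψ : IncLang.BoundedFormula α k)
    (h : ψ.IsQF) (b : Prop) : ∃ φ : IncLang.BoundedFormula α k, φ.IsQF ∧
      ∀ (M : Type u) [IncLang.Structure M] (v : α → M) (xs : Fin k → M),
        φ.Realize v xs ↔ (ψ.Realize v xs ↔ b) := by
  by_cases hb : b
  · exact ⟨ψ, h, fun M _ v xs => by simp [hb]⟩
  · exact ⟨ψ.not, h.not, fun M _ v xs => by simp [hb]⟩

/-- Formulas for the three atomic relations between bound variables, and for parameters. -/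
theorem exists_eqF {α : Type*} {k : ℕ} (i j : α ⊕ Fin k) : ∃ φ : IncLang.BoundedFormula α k, φ.IsQF ∧
      ∀ (M : Type u) [IncLang.Structure M] (v : α → M) (xs : Fin k → M),
        φ.Realize v xs ↔ Sum.elim v xs i = Sum.elim v xs j :=
  ⟨(Term.var i).bdEqual (Term.var j), (BoundedFormula.IsAtomic.equal _ _).isQF,
    fun M _ v xs => Iff.rfl⟩

theorem exists_ptF {α : Type*} {k : ℕ} (i : α ⊕ Fin k) : ∃ φ : IncLang.BoundedFormula α k, φ.IsQF ∧
      ∀ (M : Type u) [IncLang.Structure M] (v : α → M) (xs : Fin k → M),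
        φ.Realize v xs ↔ ptL (Sum.elim v xs i) :=
  ⟨Relations.boundedFormula₁ (L := IncLang) (IncRel.pt : IncLang.Relations 1) (Term.var i),
    (BoundedFormula.IsAtomic.rel _ _).isQF,
    fun M _ v xs => BoundedFormula.realize_rel₁⟩

theorem exists_incF {α : Type*} {k : ℕ} (i j : α ⊕ Fin k) :
    ∃ φ : IncLang.BoundedFormula α k, φ.IsQF ∧
      ∀ (M : Type u) [IncLang.Structure M] (v : α → M) (xs : Fin k → M),
        φ.Realize v xs ↔ incL (Sum.elim v xs i) (Sum.elim v xs j) :=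
  ⟨Relations.boundedFormula₂ (L := IncLang) (IncRel.inc : IncLang.Relations 2)
    (Term.var i) (Term.var j),
    (BoundedFormula.IsAtomic.rel _ _).isQF,
    fun M _ v xs => BoundedFormula.realize_rel₂⟩

theorem IsECL.ec {N : Type u} [IncLang.Structure N] (h : IsECL 2 2 N) : EC (toGeo h.1 h.2.1) := by
  classical
  intro Y H f hf T hT
  rcases isEmpty_or_nonempty Y with hY | ⟨⟨y0⟩⟩
  · exact ⟨fun y => hY.elim y, ⟨fun y => hY.elim y, fun y => hY.elim y, fun y => hY.elim y⟩,
      fun s => hY.elim (f s)⟩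
  letI := ofGeo H
  have hT' : (insert y0 T).Finite := hT.insert y0
  obtain ⟨k, xs, hxs⟩ : ∃ (k : ℕ) (xs : Fin k → Y), Set.range xs = insert y0 T := by
    haveI := hT'.to_subtype
    obtain ⟨k, ⟨e⟩⟩ := Finite.exists_equiv_fin (↥(insert y0 T))
    exact ⟨k, fun i => (e.symm i : Y), by
      rw [show (fun i => (e.symm i : Y)) = Subtype.val ∘ e.symm from rfl, Set.range_comp]; simp; rfl⟩
  -- the formula
  have A1 : ∀ i j : Fin k, ∃ φ : IncLang.BoundedFormula N k, φ.IsQF ∧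
      ∀ (M : Type u) [IncLang.Structure M] (v : N → M) (zs : Fin k → M),
        φ.Realize v zs ↔ (zs i = zs j ↔ xs i = xs j) := fun i j => by
    obtain ⟨ψ, h1, h2⟩ := exists_eqF.{u} (α := N) (.inr i) (.inr j)
    obtain ⟨φ, h3, h4⟩ := exists_lit.{u} ψ h1 (xs i = xs j)
    exact ⟨φ, h3, fun M _ v zs => by rw [h4, h2]; rfl⟩
  have A2 : ∀ i : Fin k, ∃ φ : IncLang.BoundedFormula N k, φ.IsQF ∧
      ∀ (M : Type u) [IncLang.Structure M] (v : N → M) (zs : Fin k → M),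
        φ.Realize v zs ↔ (ptL (zs i) ↔ ptL (xs i)) := fun i => by
    obtain ⟨ψ, h1, h2⟩ := exists_ptF.{u} (α := N) (.inr i)
    obtain ⟨φ, h3, h4⟩ := exists_lit.{u} ψ h1 (ptL (xs i))
    exact ⟨φ, h3, fun M _ v zs => by rw [h4, h2]; rfl⟩
  have A3 : ∀ i j : Fin k, ∃ φ : IncLang.BoundedFormula N k, φ.IsQF ∧
      ∀ (M : Type u) [IncLang.Structure M] (v : N → M) (zs : Fin k → M),
        φ.Realize v zs ↔ (incL (zs i) (zs j) ↔ incL (xs i) (xs j)) := fun i j => by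
    obtain ⟨ψ, h1, h2⟩ := exists_incF.{u} (α := N) (.inr i) (.inr j)
    obtain ⟨φ, h3, h4⟩ := exists_lit.{u} ψ h1 (incL (xs i) (xs j))
    exact ⟨φ, h3, fun M _ v zs => by rw [h4, h2]; rfl⟩
  have A4 : ∀ i : Fin k, ∃ φ : IncLang.BoundedFormula N k, φ.IsQF ∧
      ∀ (M : Type u) [IncLang.Structure M] (v : N → M) (zs : Fin k → M),
        φ.Realize v zs ↔ (∀ s, f s = xs i → zs i = v s) := fun i => by
    by_cases hs : ∃ s, f s = xs i
    · obtain ⟨s, hs⟩ := hs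
      obtain ⟨ψ, h1, h2⟩ := exists_eqF.{u} (α := N) (.inr i) (.inl s)
      refine ⟨ψ, h1, fun M _ v zs => ?_⟩
      rw [h2]
      constructor
      · intro h3 s' hs'
        have : s' = s := hf.inj _ trivial _ trivial (hs'.trans hs.symm)
        rw [this]; exact h3
      · intro h3; exact h3 s hs
    · push Not at hs
      exact ⟨⊤, BoundedFormula.IsQF.top, fun M _ v zs => by simp [hs]⟩
  choose φ1 a1 b1 using A1
  choose φ2 a2 b2 using A2
  choose φ3 a3 b3 using A3
  choose φ4 a4 b4 using A4
  obtain ⟨φ, c1, c2⟩ := exists_conj.{u} (β := (Fin k × Fin k) × Fin 4)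
    (fun b => ![φ1 b.1.1 b.1.2, φ2 b.1.1, φ3 b.1.1 b.1.2, φ4 b.1.1] b.2)
    (by rintro ⟨⟨i, j⟩, c⟩; fin_cases c <;> simp [a1, a2, a3, a4])
  have key : ∀ (M : Type u) [IncLang.Structure M] (v : N → M) (zs : Fin k → M),
      φ.Realize v zs ↔ ∀ i j, (zs i = zs j ↔ xs i = xs j) ∧ (ptL (zs i) ↔ ptL (xs i)) ∧
        (incL (zs i) (zs j) ↔ incL (xs i) (xs j)) ∧ (∀ s, f s = xs i → zs i = v s) := by
    intro M _ v zs
    rw [c2]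
    constructor
    · intro h i j
      have q1 := h ((i, j), 0)
      have q2 := h ((i, j), 1)
      have q3 := h ((i, j), 2)
      have q4 := h ((i, j), 3)
      exact ⟨(b1 i j M v zs).1 q1, (b2 i M v zs).1 q2, (b3 i j M v zs).1 q3, (b4 i M v zs).1 q4⟩
    · rintro h ⟨⟨i, j⟩, c⟩
      obtain ⟨q1, q2, q3, q4⟩ := h i j
      fin_cases c
      · exact (b1 i j M v zs).2 q1
      · exact (b2 i M v zs).2 q2
      · exact (b3 i j M v zs).2 q3
      · exact (b4 i M v zs).2 q4
  obtain ⟨zs, hzs⟩ := h.2.2 Y (ofGeo_inci H) (ofGeo_kfree H)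
    (mkEmb h.1 (ofGeo_inci H) f (fun x y => hf.inj x trivial y trivial)
      (fun x => hf.pt x trivial) (fun x y => hf.inc x trivial y trivial)) k φ c1
    ⟨xs, (key Y _ xs).2 fun i j => ⟨Iff.rfl, Iff.rfl, Iff.rfl, fun s hs => hs.symm⟩⟩
  rw [key] at hzs
  have hi : ∀ y ∈ T, ∃ i, xs i = y := fun y hy => by
    have : y ∈ Set.range xs := hxs ▸ Set.mem_insert_of_mem _ hy
    exact this
  obtain ⟨i0, -⟩ : ∃ i, xs i = y0 := by
    have : y0 ∈ Set.range xs := hxs ▸ Set.mem_insert _ _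
    exact this
  let g : Y → N := fun y => if hy : ∃ i, xs i = y then zs hy.choose else zs i0
  have hg : ∀ i, g (xs i) = zs i := by
    intro i
    have hy : ∃ j, xs j = xs i := ⟨i, rfl⟩
    simp only [g, dif_pos hy]
    exact (hzs _ _).1.2 hy.choose_spec
  refine ⟨g, ⟨?_, ?_, ?_⟩, ?_⟩
  · intro x hx y hy hxy
    obtain ⟨i, rfl⟩ := hi x hx
    obtain ⟨j, rfl⟩ := hi y hy
    rw [hg, hg] at hxy
    exact (hzs i j).1.1 hxy
  · intro x hx
    obtain ⟨i, rfl⟩ := hi x hx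
    rw [hg]
    exact (hzs i i).2.1
  · intro x hx y hy
    obtain ⟨i, rfl⟩ := hi x hx
    obtain ⟨j, rfl⟩ := hi y hy
    rw [hg, hg]
    exact (hzs i j).2.2.1
  · intro s hs
    obtain ⟨i, hi⟩ := hi _ hs
    rw [← hi, hg]
    exact (hzs i i).2.2.2 s hi.symm

/-- Realization of a quantifier-free formula depends on finitely many parameters. -/
theorem qf_dep {α : Type u} {k : ℕ} (φ : IncLang.BoundedFormula α k) (hφ : φ.IsQF) :
    ∃ S : Set α, S.Finite ∧ ∀ (M N : Type u) [IncLang.Structure M] [IncLang.Structure N]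
      (v : α → M) (xs : Fin k → M) (v' : α → N) (xs' : Fin k → N),
      IsIncidenceL M → IsIncidenceL N →
      (∀ i ∈ Sum.inl '' S ∪ Set.range Sum.inr, ∀ j ∈ Sum.inl '' S ∪ Set.range Sum.inr,
        (Sum.elim v xs i = Sum.elim v xs j ↔ Sum.elim v' xs' i = Sum.elim v' xs' j) ∧
        (ptL (Sum.elim v xs i) ↔ ptL (Sum.elim v' xs' i)) ∧
        (incL (Sum.elim v xs i) (Sum.elim v xs j) ↔
          incL (Sum.elim v' xs' i) (Sum.elim v' xs' j))) →
      (φ.Realize v xs ↔ φ.Realize v' xs') := by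
  induction hφ with
  | falsum => exact ⟨∅, Set.finite_empty, fun _ _ _ _ _ _ _ _ _ _ _ => Iff.rfl⟩
  | imp h1 h2 ih1 ih2 =>
    obtain ⟨S1, f1, g1⟩ := ih1
    obtain ⟨S2, f2, g2⟩ := ih2
    refine ⟨S1 ∪ S2, f1.union f2, fun M N _ _ v xs v' xs' hM hN h => ?_⟩
    rw [BoundedFormula.realize_imp, BoundedFormula.realize_imp,
      g1 M N v xs v' xs' hM hN (fun i hi j hj => h i ?_ j ?_),
      g2 M N v xs v' xs' hM hN (fun i hi j hj => h i ?_ j ?_)]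
    · rw [Set.image_union]; grind
    · rw [Set.image_union]; grind
    · rw [Set.image_union]; grind
    · rw [Set.image_union]; grind
  | of_isAtomic h =>
    cases h with
    | equal t1 t2 =>
      obtain ⟨a, rfl⟩ := term_var t1
      obtain ⟨b, rfl⟩ := term_var t2
      refine ⟨{x | Sum.inl x = a ∨ Sum.inl x = b}, ?_, fun M N _ _ v xs v' xs' hM hN h => ?_⟩
      · exact ((Set.finite_singleton a).union (Set.finite_singleton b)).preimage
          (Sum.inl_injective.injOn) |>.subset (by intro x hx; simpa [or_comm] using hx)
      · exact (h a (by cases a <;> simp) b (by cases b <;> simp)).1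
    | rel R ts =>
      choose a ha using fun i => term_var (ts i)
      refine ⟨{x | Sum.inl x ∈ Set.range a}, ?_, fun M N _ _ v xs v' xs' hM hN h => ?_⟩
      · exact (Set.finite_range a).preimage (Sum.inl_injective.injOn)
      · have hm : ∀ i, a i ∈ Sum.inl '' {x | Sum.inl x ∈ Set.range a} ∪ Set.range Sum.inr := by
          intro i
          rcases hai : a i with x | y
          · left; exact ⟨x, ⟨i, hai⟩, rfl⟩
          · right; exact ⟨y, rfl⟩
        rw [BoundedFormula.realize_rel, BoundedFormula.realize_rel]
        apply relMap_iff
        · intro i; simp only [ha]; exact (h _ (hm i) _ (hm i)).2.1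
        · intro i; simp only [ha]; rw [ln_iff hM, ln_iff hN]
          exact not_congr (h _ (hm i) _ (hm i)).2.1
        · intro i j; simp only [ha]; exact (h _ (hm i) _ (hm j)).2.2

theorem EC.isECL {N : Type u} {G : Geo N} (h : EC G) : @IsECL 2 2 N (ofGeo G) := by
  letI := ofGeo G
  refine ⟨ofGeo_inci G, ofGeo_kfree G, ?_⟩
  intro Y _ hY1 hY2 f k φ hφ ⟨xs, hxs⟩
  obtain ⟨S, hS1, hS2⟩ := qf_dep φ hφ
  obtain ⟨g, hg1, hg2⟩ := h Y (toGeo hY1 hY2) f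
    (emb_Emb f (ofGeo_inci G) (ofGeo_kfree G) hY1 hY2) (f '' S ∪ Set.range xs)
    ((hS1.image _).union (Set.finite_range _))
  refine ⟨fun i => g (xs i), ?_⟩
  refine (hS2 Y N f xs id (fun i => g (xs i)) hY1 (ofGeo_inci G) ?_).1 hxs
  have e : ∀ i ∈ Sum.inl '' S ∪ Set.range Sum.inr,
      Sum.elim f xs i ∈ f '' S ∪ Set.range xs ∧
      Sum.elim id (fun i => g (xs i)) i = g (Sum.elim f xs i) := by
    rintro i (⟨s, hs, rfl⟩ | ⟨j, rfl⟩)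
    · exact ⟨Or.inl ⟨s, hs, rfl⟩, (hg2 s (Or.inl ⟨s, hs, rfl⟩)).symm⟩
    · exact ⟨Or.inr ⟨j, rfl⟩, rfl⟩
  intro i hi j hj
  obtain ⟨i1, i2⟩ := e i hi
  obtain ⟨j1, j2⟩ := e j hj
  rw [i2, j2]
  exact ⟨⟨fun h => by rw [h], fun h => hg1.inj _ i1 _ j1 h⟩, (hg1.pt _ i1).symm,
    (hg1.inc _ i1 _ j1).symm⟩


/-- Formal join/meet terms of depth `k`. -/
def TT (ι : Type) : ℕ → Type
  | 0 => ι
  | k + 1 => TT ι k × TT ι k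

theorem TT_finite (ι : Type) [Finite ι] : ∀ k, Finite (TT ι k)
  | 0 => ‹Finite ι›
  | k + 1 => by
    haveI := TT_finite ι k
    exact (inferInstance : Finite (TT ι k × TT ι k))

/-- Evaluation of terms. -/
noncomputable def ev {N : Type*} (G : Geo N) {ι : Type} (a : ι → N) : (k : ℕ) → TT ι k → N
  | 0, i => a i
  | k + 1, p => G.op (ev G a k p.1) (ev G a k p.2)

/-- The diagonal inclusion of variables. -/
def dg {ι : Type} (i : ι) : (k : ℕ) → TT ι k
  | 0 => i
  | k + 1 => (dg i k, dg i k)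

theorem ev_dg {N : Type*} (G : Geo N) {ι : Type} (a : ι → N) (i : ι) :
    ∀ k, ev G a k (dg i k) = a i
  | 0 => rfl
  | k + 1 => by
    change G.op (ev G a k (dg i k)) (ev G a k (dg i k)) = _
    rw [Geo.op_self, ev_dg G a i k]

theorem ev_diag {N : Type*} (G : Geo N) {ι : Type} (a : ι → N) (k : ℕ) (t : TT ι k) :
    ev G a (k + 1) (t, t) = ev G a k t := by
  change G.op (ev G a k t) (ev G a k t) = _
  rw [Geo.op_self]

theorem range_ev_succ {N : Type*} (G : Geo N) {ι : Type} (a : ι → N) (k : ℕ) :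
    Set.range (ev G a k) ⊆ Set.range (ev G a (k + 1)) := by
  rintro _ ⟨t, rfl⟩
  exact ⟨(t, t), ev_diag G a k t⟩

theorem range_ev_mono {N : Type*} (G : Geo N) {ι : Type} (a : ι → N) :
    Monotone (fun k => Set.range (ev G a k)) :=
  monotone_nat_of_le_succ (range_ev_succ G a)

/-- Equivalence up to depth `k`. -/
def SimK {N N' : Type*} (G : Geo N) (G' : Geo N') {ι : Type} (k : ℕ) (a : ι → N) (a' : ι → N') :
    Prop :=
  ∀ s t : TT ι k, (ev G a k s = ev G a k t ↔ ev G' a' k s = ev G' a' k t) ∧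
    (G.pt (ev G a k s) ↔ G'.pt (ev G' a' k s)) ∧
    (G.inc (ev G a k s) (ev G a k t) ↔ G'.inc (ev G' a' k s) (ev G' a' k t))

theorem SimK.pred {N N' : Type*} {G : Geo N} {G' : Geo N'} {ι : Type} {k : ℕ} {a : ι → N}
    {a' : ι → N'} (h : SimK G G' (k + 1) a a') : SimK G G' k a a' := by
  intro s t
  have := h (s, s) (t, t)
  simpa only [ev_diag] using this

theorem SimK.mono {N N' : Type*} {G : Geo N} {G' : Geo N'} {ι : Type} {k j : ℕ} {a : ι → N}
    {a' : ι → N'} (h : SimK G G' k a a') (hj : j ≤ k) : SimK G G' j a a' := by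
  induction hj with
  | refl => exact h
  | step _ ih => exact ih h.pred

theorem SimK.symm {N N' : Type*} {G : Geo N} {G' : Geo N'} {ι : Type} {k : ℕ} {a : ι → N}
    {a' : ι → N'} (h : SimK G G' k a a') : SimK G' G k a' a := fun s t =>
  ⟨(h s t).1.symm, (h s t).2.1.symm, (h s t).2.2.symm⟩

theorem stab {N : Type*} (C : Set N) (hC : C.Finite) (R : ℕ → Set N) (hR : Monotone R) :
    ∃ j ≤ C.ncard, C ∩ R (j + 1) ⊆ C ∩ R j := by
  by_contra hcon
  push Not at hcon
  have key : ∀ j ≤ C.ncard + 1, j ≤ (C ∩ R j).ncard := by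
    intro j
    induction j with
    | zero => intro _; exact Nat.zero_le _
    | succ j ih =>
      intro hj
      have h1 := ih (by omega)
      have h2 : (C ∩ R j) ⊂ (C ∩ R (j + 1)) :=
        ⟨Set.inter_subset_inter_right _ (hR (Nat.le_succ j)), hcon j (by omega)⟩
      have := Set.ncard_lt_ncard h2 (hC.subset Set.inter_subset_left)
      omega
  have h1 := key _ le_rfl
  have h2 := Set.ncard_le_ncard (s := C ∩ R (C.ncard + 1)) Set.inter_subset_left hC
  omega

theorem sim_step {N N' : Type u} {G : Geo N} {G' : Geo N'} (hG : EC G) (hG' : EC G')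
    {ι κ : Type} [Finite κ] (e : ι → κ) (k : ℕ) (c : κ → N) (a' : ι → N')
    (h : SimK G G' (Nat.card (TT κ k)) (fun i => c (e i)) a') :
    ∃ c' : κ → N', (fun i => c' (e i)) = a' ∧ SimK G G' k c c' := by
  classical
  set a : ι → N := fun i => c (e i) with ha
  haveI := TT_finite κ k
  set C : Set N := Set.range (ev G c k) with hCdef
  have hC : C.Finite := Set.finite_range _
  have hCc : C.ncard ≤ Nat.card (TT κ k) := by
    rw [← Nat.card_coe_set_eq]; exact Finite.card_range_le _
  obtain ⟨j, hj1, hj2⟩ := stab C hC (fun j => Set.range (ev G a j)) (range_ev_mono G a)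
  have hs := h.mono (hj1.trans hCc)
  let hf : N → N' := fun x => if hx : ∃ t, ev G a j t = x then ev G' a' j hx.choose else
    (if hN : Nonempty N' then hN.some else (hG' (ULift (Fin 2)) ⟨fun _ => True, fun _ _ => False,
      by simp, by simp, by simp⟩ (fun n => (hN ⟨n⟩).elim)
      ⟨fun n => (hN ⟨n⟩).elim, fun n => (hN ⟨n⟩).elim, fun n => (hN ⟨n⟩).elim⟩ ∅
        Set.finite_empty).choose ⟨0⟩)
  have hhf : ∀ t, hf (ev G a j t) = ev G' a' j t := by
    intro t
    have hx : ∃ s, ev G a j s = ev G a j t := ⟨t, rfl⟩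
    simp only [hf, dif_pos hx]
    exact (hs _ _).1.1 hx.choose_spec
  have hP : PEmb G G' (C ∩ Set.range (ev G a j)) hf := by
    refine ⟨?_, ?_, ?_⟩
    · rintro _ ⟨-, s, rfl⟩ _ ⟨-, t, rfl⟩ hst
      rw [hhf, hhf] at hst
      exact (hs s t).1.2 hst
    · rintro _ ⟨-, s, rfl⟩
      rw [hhf]; exact (hs s s).2.1.symm
    · rintro _ ⟨-, s, rfl⟩ _ ⟨-, t, rfl⟩
      rw [hhf, hhf]; exact (hs s t).2.2.symm
  have hcl : ∀ p ∈ C ∩ Set.range (ev G a j), ∀ q ∈ C ∩ Set.range (ev G a j), G.op p q ∈ C →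
      G.op p q ∈ C ∩ Set.range (ev G a j) := by
    rintro _ ⟨-, s, rfl⟩ _ ⟨-, t, rfl⟩ hC
    exact hj2 ⟨hC, (s, t), rfl⟩
  obtain ⟨g, hg1, hg2⟩ := hG'.extend G C (C ∩ Set.range (ev G a j)) hf hC Set.inter_subset_left hP
    (by
      intro p hp q hq hpq l hl hl' h1 h2 _ _ _
      have := G.op_eq hpq (Or.inl ⟨h1, h2⟩)
      exact hl' (this ▸ hcl p hp q hq (this ▸ hl)))
    (by
      intro p hp q hq hpq l hl hl' h1 h2 _ _ _
      have := G.op_eq hpq (Or.inr ⟨h1, h2⟩)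
      exact hl' (this ▸ hcl p hp q hq (this ▸ hl)))
  refine ⟨fun x => g (c x), ?_, ?_⟩
  · funext i
    have e1 : c (e i) = ev G a j (dg i j) := (ev_dg G a i j).symm
    have e2 : c (e i) ∈ C := ⟨dg (e i) k, ev_dg G c (e i) k⟩
    change g (c (e i)) = a' i
    rw [hg2 _ ⟨e2, dg i j, e1.symm⟩, e1, hhf, ev_dg]
  · have key : ∀ i ≤ k, ∀ t : TT κ i, ev G' (fun x => g (c x)) i t = g (ev G c i t) := by
      intro i
      induction i with
      | zero => intro _ t; rfl
      | succ i ih =>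
        rintro hi ⟨s, t⟩
        change G'.op (ev G' _ i s) (ev G' _ i t) = g (G.op (ev G c i s) (ev G c i t))
        rw [ih (by omega), ih (by omega)]
        exact Geo.op_map hG.plane hg1 (range_ev_mono G c (by omega : i ≤ k) ⟨s, rfl⟩)
          (range_ev_mono G c (by omega : i ≤ k) ⟨t, rfl⟩)
          (range_ev_mono G c hi ⟨(s, t), rfl⟩)
    intro s t
    rw [key k le_rfl, key k le_rfl]
    exact ⟨⟨fun h => by rw [h], fun h => hg1.inj _ ⟨s, rfl⟩ _ ⟨t, rfl⟩ h⟩,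
      (hg1.pt _ ⟨s, rfl⟩).symm, (hg1.inc _ ⟨s, rfl⟩ _ ⟨t, rfl⟩).symm⟩

theorem elem_sim {α : Type} [Finite α] {n : ℕ} (φ : IncLang.BoundedFormula α n) :
    ∃ k, ∀ (M N : Type u) [IncLang.Structure M] [IncLang.Structure N] (hM : IsECL 2 2 M)
      (hN : IsECL 2 2 N) (v : α → M) (xs : Fin n → M) (v' : α → N) (xs' : Fin n → N),
      SimK (toGeo hM.1 hM.2.1) (toGeo hN.1 hN.2.1) k (Sum.elim v xs) (Sum.elim v' xs') →
      (φ.Realize v xs ↔ φ.Realize v' xs') := by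
  induction φ with
  | falsum => exact ⟨0, fun _ _ _ _ _ _ _ _ _ _ _ => Iff.rfl⟩
  | equal t1 t2 =>
    obtain ⟨a, rfl⟩ := term_var t1
    obtain ⟨b, rfl⟩ := term_var t2
    exact ⟨0, fun M N _ _ hM hN v xs v' xs' h => (h a b).1⟩
  | rel R ts =>
    choose a ha using fun i => term_var (ts i)
    refine ⟨0, fun M N _ _ hM hN v xs v' xs' h => ?_⟩
    change Structure.RelMap R (fun i => (ts i).realize (Sum.elim v xs)) ↔
      Structure.RelMap R (fun i => (ts i).realize (Sum.elim v' xs'))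
    apply relMap_iff
    · intro i; simp only [ha]; exact (h (a i) (a i)).2.1
    · intro i; simp only [ha]; rw [ln_iff hM.1, ln_iff hN.1]
      exact not_congr (h (a i) (a i)).2.1
    · intro i j; simp only [ha]; exact (h (a i) (a j)).2.2
  | imp φ ψ ih1 ih2 =>
    obtain ⟨k1, h1⟩ := ih1
    obtain ⟨k2, h2⟩ := ih2
    refine ⟨max k1 k2, fun M N _ _ hM hN v xs v' xs' h => ?_⟩
    rw [BoundedFormula.realize_imp, BoundedFormula.realize_imp,
      h1 M N hM hN v xs v' xs' (h.mono (le_max_left _ _)),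
      h2 M N hM hN v xs v' xs' (h.mono (le_max_right _ _))]
  | @all n φ ih =>
    obtain ⟨k, hk⟩ := ih
    refine ⟨Nat.card (TT (α ⊕ Fin (n + 1)) k), ?_⟩
    have half : ∀ (M N : Type u) [IncLang.Structure M] [IncLang.Structure N] (hM : IsECL 2 2 M)
      (hN : IsECL 2 2 N) (v : α → M) (xs : Fin n → M) (v' : α → N) (xs' : Fin n → N),
      SimK (toGeo hM.1 hM.2.1) (toGeo hN.1 hN.2.1) (Nat.card (TT (α ⊕ Fin (n + 1)) k))
        (Sum.elim v xs) (Sum.elim v' xs') →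
      (φ.all.Realize v' xs' → φ.all.Realize v xs) := by
      intro M N _ _ hM hN v xs v' xs' h h' x
      have e0 : (fun i => Sum.elim v (Fin.snoc xs x : Fin (n + 1) → M)
          (Sum.map id Fin.castSucc i)) = Sum.elim v xs := by
        funext i; rcases i with i | i <;> simp
      obtain ⟨c', hc1, hc2⟩ := sim_step hM.ec hN.ec
        (Sum.map id Fin.castSucc : α ⊕ Fin n → α ⊕ Fin (n + 1)) k
        (Sum.elim v (Fin.snoc xs x : Fin (n + 1) → M)) (Sum.elim v' xs') (by rw [e0]; exact h)
      have e1 : c' = Sum.elim v' (Fin.snoc xs' (c' (.inr (Fin.last n))) : Fin (n + 1) → N) := by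
        funext i
        rcases i with i | i
        · exact congrFun hc1 (.inl i)
        · refine Fin.lastCases ?_ (fun i => ?_) i
          · simp
          · simpa using congrFun hc1 (.inr i)
      rw [e1] at hc2
      exact (hk M N hM hN _ _ _ _ hc2).2 (h' _)
    intro M N _ _ hM hN v xs v' xs' h
    exact ⟨half N M hN hM v' xs' v xs h.symm, half M N hM hN v xs v' xs' h⟩

theorem sim_of_emb {N N' : Type*} {G : Geo N} {G' : Geo N'} (hG : Plane G) {f : N → N'}
    (hf : Emb G G' f) {ι : Type} (a : ι → N) (k : ℕ) : SimK G G' k a (fun i => f (a i)) := by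
  have key : ∀ i, ∀ t : TT ι i, ev G' (fun x => f (a x)) i t = f (ev G a i t) := by
    intro i
    induction i with
    | zero => intro t; rfl
    | succ i ih =>
      rintro ⟨s, t⟩
      change G'.op (ev G' _ i s) (ev G' _ i t) = f (G.op (ev G a i s) (ev G a i t))
      rw [ih, ih]
      exact Geo.op_map hG hf trivial trivial trivial
  intro s t
  rw [key, key]
  exact ⟨⟨fun h => by rw [h], fun h => hf.inj _ trivial _ trivial h⟩,
      (hf.pt _ trivial).symm, (hf.inc _ trivial _ trivial).symm⟩

/-- Embeddings between existentially closed structures are elementary. -/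
theorem elem_of_emb {M N : Type u} [IncLang.Structure M] [IncLang.Structure N] (hM : IsECL 2 2 M)
    (hN : IsECL 2 2 N) (f : M → N) (hf : Emb (toGeo hM.1 hM.2.1) (toGeo hN.1 hN.2.1) f) :
    Nonempty (M ↪ₑ[IncLang] N) := by
  refine ⟨⟨f, fun n φ x => ?_⟩⟩
  obtain ⟨k, hk⟩ := elem_sim.{u} φ
  refine (hk M N hM hN x default (f ∘ x) default ?_).symm
  have := sim_of_emb hM.ec.plane hf (Sum.elim x (default : Fin 0 → M)) k
  convert this using 1
  funext i
  rcases i with i | i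
  · rfl
  · exact i.elim0


/-- Finite conditions: finite partial planes on a subset of `X`. -/
structure Cond (X : Type u) where
  dom : Finset X
  G : Geo X
  pt_dom : ∀ x, G.pt x → x ∈ dom
  inc_dom : ∀ x y, G.inc x y → x ∈ dom ∧ y ∈ dom

/-- The condition is an induced substructure. -/
def Cond.Sub {X : Type u} (c : Cond X) (G : Geo X) : Prop := PEmb c.G G ↑c.dom id

theorem Cond.sub_self {X : Type u} (c : Cond X) : c.Sub c.G :=
  ⟨fun _ _ _ _ h => h, fun _ _ => Iff.rfl, fun _ _ _ _ => Iff.rfl⟩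

theorem Cond.Sub.pt {X : Type u} {c : Cond X} {G : Geo X} (h : c.Sub G) {x : X} (hx : x ∈ c.dom) :
    G.pt x ↔ c.G.pt x := PEmb.pt h x hx

theorem Cond.Sub.inc {X : Type u} {c : Cond X} {G : Geo X} (h : c.Sub G) {x y : X}
    (hx : x ∈ c.dom) (hy : y ∈ c.dom) : G.inc x y ↔ c.G.inc x y := PEmb.inc h x hx y hy

theorem Cond.Sub.inc' {X : Type u} {c : Cond X} {G : Geo X} (h : c.Sub G) {x y : X}
    (hxy : c.G.inc x y) : G.inc x y :=
  (h.inc (c.inc_dom x y hxy).1 (c.inc_dom x y hxy).2).2 hxy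

instance {X : Type u} : Preorder (Cond X) where
  le c d := c.dom ⊆ d.dom ∧ c.Sub d.G
  le_refl c := ⟨subset_rfl, c.sub_self⟩
  le_trans a b c h1 h2 := ⟨h1.1.trans h2.1, PEmb.comp h2.2 h1.2 (fun x hx => h1.1 hx)⟩

theorem Cond.Sub.of_le {X : Type u} {c d : Cond X} {G : Geo X} (hcd : c ≤ d) (h : d.Sub G) :
    c.Sub G := PEmb.comp h hcd.2 (fun x hx => hcd.1 hx)

theorem Cond.le_of_sub {X : Type u} {c d : Cond X} {G : Geo X} (hcd : c.dom ⊆ d.dom)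
    (hc : c.Sub G) (hd : d.Sub G) : c ≤ d := by
  refine ⟨hcd, fun _ _ _ _ h => h, fun x hx => ?_, fun x hx y hy => ?_⟩
  · rw [← hc.pt hx]; exact (hd.pt (hcd hx)).symm
  · rw [← hc.inc hx hy]; exact (hd.inc (hcd hx) (hcd hy)).symm

instance {X : Type u} : Inhabited (Cond X) :=
  ⟨⟨∅, ⟨fun _ => False, fun _ _ => False, by simp, by simp, by simp⟩, by simp, by simp⟩⟩

theorem Cond.countable {X : Type u} [Countable X] : Countable (Cond X) := by
  classical
  let F : Cond X → Finset X × Finset X × Finset (X × X) := fun c =>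
    (c.dom, c.dom.filter (fun x => c.G.pt x),
      (c.dom ×ˢ c.dom).filter (fun x => c.G.inc x.1 x.2))
  refine Function.Injective.countable (f := F) ?_
  rintro ⟨d1, ⟨p1, i1, a1, b1, k1⟩, e1, f1⟩ ⟨d2, ⟨p2, i2, a2, b2, k2⟩, e2, f2⟩ h
  simp only [F, Prod.mk.injEq] at h
  obtain ⟨rfl, h2, h3⟩ := h
  have hp : p1 = p2 := by
    funext x
    have := congrArg (fun s => x ∈ s) h2
    simp only [Finset.mem_filter] at this
    have q1 := e1 x
    have q2 := e2 x
    simp only at q1 q2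
    apply propext
    grind
  have hi : i1 = i2 := by
    funext x y
    have := congrArg (fun s => (x, y) ∈ s) h3
    simp only [Finset.mem_filter, Finset.mem_product] at this
    have q1 := f1 x y
    have q2 := f2 x y
    simp only at q1 q2
    apply propext
    grind
  subst hp hi
  rfl

/-- Restriction of a partial plane to a finite set. -/
def mkCond {X : Type u} (G : Geo X) (F : Finset X) : Cond X where
  dom := F
  G :=
    { pt := fun x => x ∈ F ∧ G.pt x
      inc := fun x y => x ∈ F ∧ y ∈ F ∧ G.inc x y
      inc_pt := fun x y h => ⟨h.1, G.inc_pt x y h.2.2⟩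
      inc_ln := fun x y h h' => G.inc_ln x y h.2.2 h'.2
      k22 := fun p q l m h1 h2 h3 h4 => G.k22 p q l m h1.2.2 h2.2.2 h3.2.2 h4.2.2 }
  pt_dom := fun x h => h.1
  inc_dom := fun x y h => ⟨h.1, h.2.1⟩

theorem mkCond_sub {X : Type u} (G : Geo X) (F : Finset X) : (mkCond G F).Sub G := by
  refine ⟨fun _ _ _ _ h => h, fun x hx => ?_, fun x hx y hy => ?_⟩
  · have : x ∈ F := hx
    simp [mkCond, this]
  · have h1 : x ∈ F := hx
    have h2 : y ∈ F := hy
    simp [mkCond, h1, h2]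

theorem Cond.grow {X : Type u} (c : Cond X) (F : Finset X) : ∃ d, c ≤ d ∧ F ⊆ d.dom := by
  classical
  exact ⟨⟨c.dom ∪ F, c.G, fun x h => Finset.mem_union_left _ (c.pt_dom x h),
    fun x y h => ⟨Finset.mem_union_left _ (c.inc_dom x y h).1,
      Finset.mem_union_left _ (c.inc_dom x y h).2⟩⟩,
    ⟨Finset.subset_union_left, c.sub_self⟩, Finset.subset_union_right⟩

theorem PEmb.inv {X Y : Type*} [Nonempty X] {G : Geo X} {H : Geo Y} {T : Set X} {g : X → Y}
    (h : PEmb G H T g) : ∃ t : Y → X, (∀ x ∈ T, t (g x) = x) ∧ PEmb H G (g '' T) t := by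
  have hi : Set.InjOn g T := fun x hx y hy => h.inj x hx y hy
  have e : ∀ x ∈ T, Function.invFunOn g T (g x) = x := fun x hx => hi.leftInvOn_invFunOn hx
  refine ⟨Function.invFunOn g T, e, ?_, ?_, ?_⟩
  · rintro _ ⟨x, hx, rfl⟩ _ ⟨y, hy, rfl⟩ hxy
    rw [e x hx, e y hy] at hxy; rw [hxy]
  · rintro _ ⟨x, hx, rfl⟩
    rw [e x hx, h.pt x hx]
  · rintro _ ⟨x, hx, rfl⟩ _ ⟨y, hy, rfl⟩
    rw [e x hx, e y hy, h.inc x hx y hy]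

/-- Transport a finite configuration extending a condition to a condition. -/
theorem Cond.push {X : Type u} [Infinite X] (c : Cond X) {Y : Type v} (H : Geo Y) (U : Set Y)
    (hU : U.Finite) (f : X → Y) (hf : PEmb c.G H ↑c.dom f) (hfU : ∀ x ∈ c.dom, f x ∈ U) :
    ∃ d, c ≤ d ∧ ∃ r : Y → X, PEmb H d.G U r ∧ ↑d.dom = r '' U ∧ ∀ x ∈ c.dom, r (f x) = x := by
  classical
  have hinf : ((c.dom : Set X)ᶜ).Infinite := c.dom.finite_toSet.infinite_compl
  haveI := hU.to_subtype
  obtain ⟨k, ⟨e⟩⟩ := Finite.exists_equiv_fin U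
  let ν := hinf.natEmbedding
  let x0 : X := (ν 0 : X)
  let r : Y → X := fun y => if h : ∃ x ∈ c.dom, f x = y then h.choose else
    if h : y ∈ U then (ν (e ⟨y, h⟩) : X) else x0
  have r1 : ∀ x ∈ c.dom, r (f x) = x := by
    intro x hx
    have h : ∃ x' ∈ c.dom, f x' = f x := ⟨x, hx, rfl⟩
    simp only [r, dif_pos h]
    exact hf.inj _ h.choose_spec.1 _ hx h.choose_spec.2
  have r2 : ∀ y, ¬ (∃ x ∈ c.dom, f x = y) → r y ∉ c.dom := by
    intro y h
    simp only [r, dif_neg h]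
    split_ifs
    · exact fun h' => (ν _).2 h'
    · exact fun h' => (ν _).2 h'
  have rinj : ∀ y ∈ U, ∀ z ∈ U, r y = r z → y = z := by
    intro y hy z hz hyz
    by_cases h1 : ∃ x ∈ c.dom, f x = y
    · obtain ⟨x, hx, rfl⟩ := h1
      by_cases h2 : ∃ x ∈ c.dom, f x = z
      · obtain ⟨x', hx', rfl⟩ := h2
        rw [r1 _ hx, r1 _ hx'] at hyz; rw [hyz]
      · have := r2 z h2
        rw [← hyz, r1 _ hx] at this
        exact absurd hx this
    · by_cases h2 : ∃ x ∈ c.dom, f x = z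
      · obtain ⟨x', hx', rfl⟩ := h2
        have := r2 y h1
        rw [hyz, r1 _ hx'] at this
        exact absurd hx' this
      · simp only [r, dif_neg h1, dif_neg h2, dif_pos hy, dif_pos hz] at hyz
        have := ν.injective (Subtype.ext hyz)
        have := e.injective (Fin.ext this)
        exact congrArg Subtype.val this
  let d : Cond X :=
    { dom := (hU.image r).toFinset
      G :=
        { pt := fun x => ∃ y ∈ U, r y = x ∧ H.pt y
          inc := fun x x' => ∃ y ∈ U, ∃ y' ∈ U, r y = x ∧ r y' = x' ∧ H.inc y y'
          inc_pt := by
            rintro x x' ⟨y, hy, y', hy', h1, h2, h3⟩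
            exact ⟨y, hy, h1, H.inc_pt _ _ h3⟩
          inc_ln := by
            rintro x x' ⟨y, hy, y', hy', h1, h2, h3⟩ ⟨y2, hy2, h4, h5⟩
            obtain rfl := rinj y2 hy2 y' hy' (h4.trans h2.symm)
            exact H.inc_ln _ _ h3 h5
          k22 := by
            rintro _ _ _ _ ⟨p, hp, l, hl, rfl, rfl, h3⟩ ⟨q, hq, l1, hl1, rfl, e1, h4⟩
              ⟨p1, hp1, m, hm, e2, rfl, h5⟩ ⟨q1, hq1, m1, hm1, e3, e4, h6⟩
            obtain rfl := rinj _ hl1 _ hl e1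
            obtain rfl := rinj _ hp1 _ hp e2
            obtain rfl := rinj _ hq1 _ hq e3
            obtain rfl := rinj _ hm1 _ hm e4
            rcases H.k22 _ _ _ _ h3 h4 h5 h6 with rfl | rfl
            · exact Or.inl rfl
            · exact Or.inr rfl }
      pt_dom := by
        rintro _ ⟨y, hy, rfl, h⟩
        rw [Set.Finite.mem_toFinset]; exact ⟨y, hy, rfl⟩
      inc_dom := by
        rintro _ _ ⟨y, hy, y', hy', rfl, rfl, h⟩
        rw [Set.Finite.mem_toFinset, Set.Finite.mem_toFinset]
        exact ⟨⟨y, hy, rfl⟩, ⟨y', hy', rfl⟩⟩ }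
  have hd : PEmb H d.G U r := by
    refine ⟨rinj, fun y hy => ⟨?_, fun h => ⟨y, hy, rfl, h⟩⟩, fun y hy z hz => ⟨?_, fun h =>
      ⟨y, hy, z, hz, rfl, rfl, h⟩⟩⟩
    · rintro ⟨y', hy', h1, h2⟩
      obtain rfl := rinj _ hy' _ hy h1
      exact h2
    · rintro ⟨y', hy', z', hz', h1, h2, h3⟩
      obtain rfl := rinj _ hy' _ hy h1
      obtain rfl := rinj _ hz' _ hz h2
      exact h3
  refine ⟨d, ⟨?_, ?_⟩, r, hd, by simp [d], r1⟩
  · intro x hx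
    rw [← r1 x hx]
    change _ ∈ (hU.image r).toFinset
    rw [Set.Finite.mem_toFinset]
    exact ⟨_, hfU x hx, rfl⟩
  · exact (hd.comp hf hfU).congr (fun x hx => (r1 x hx).symm)

/-- Adding a fresh element to a condition. -/
theorem Cond.add {X : Type u} [Infinite X] (c : Cond X) (b : Prop) (S : Set X)
    (hSd : ∀ x ∈ S, x ∈ c.dom) (hS : ∀ x ∈ S, (c.G.pt x ↔ ¬ b))
    (hS1 : ∀ x ∈ S, ∀ y ∈ S, x ≠ y → ∀ z, c.G.inc x z → c.G.inc y z → False)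
    (hS2 : ∀ x ∈ S, ∀ y ∈ S, x ≠ y → ∀ z, c.G.inc z x → c.G.inc z y → False) :
    ∃ d v, c ≤ d ∧ v ∉ c.dom ∧ v ∈ d.dom ∧ (d.G.pt v ↔ b) ∧ (∀ x, x ≠ v → (d.G.pt x ↔ c.G.pt x)) ∧
      (∀ x y, d.G.inc x y ↔ c.G.inc x y ∨ (b ∧ x = v ∧ y ∈ S) ∨ (¬ b ∧ y = v ∧ x ∈ S)) := by
  classical
  obtain ⟨v, hv⟩ := Infinite.exists_notMem_finset c.dom
  let G := addElem c.G v b S (fun x h => hv (c.inc_dom _ _ h).2) (fun x h => hv (c.inc_dom _ _ h).1)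
    (fun h => hv (hSd v h)) hS hS1 hS2
  have hSv : ∀ x ∈ c.dom, x ≠ v := fun x hx h => hv (h ▸ hx)
  let d : Cond X := ⟨insert v c.dom, G, by
      intro x hx
      have := c.pt_dom x
      simp only [G, addElem] at hx
      grind, by
      intro x y hx
      have := c.inc_dom x y
      simp only [G, addElem] at hx
      grind⟩
  refine ⟨d, v, ⟨Finset.subset_insert _ _, fun _ _ _ _ h => h, ?_, ?_⟩, hv,
    Finset.mem_insert_self _ _, ?_, ?_, ?_⟩
  · intro x hx
    have := hSv x hx
    simp [d, G, addElem, this]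
  · intro x hx y hy
    have h1 := hSv x hx
    have h2 := hSv y hy
    simp [d, G, addElem, h1, h2]
  · simp [d, G, addElem]
  · intro x hx
    simp [d, G, addElem, hx]
  · intro x y
    rfl

theorem generic_aux {X : Type u} {J : Type*} [Countable J] (D : J → Order.Cofinal (Cond X)) :
    ∃ (c : ℕ → Cond X) (G : Geo X), Monotone c ∧ (∀ n, (c n).Sub G) ∧
      ∀ j, ∃ n, c n ∈ D j := by
  haveI := Encodable.ofCountable J
  let c : ℕ → Cond X := Order.sequenceOfCofinals default D
  have hc : Monotone c := Order.sequenceOfCofinals.monotone _ _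
  have P : ∀ m n x, x ∈ (c n).dom → (c m).G.pt x → (c n).G.pt x := by
    intro m n x hx h
    rcases le_total m n with h' | h'
    · exact ((hc h').2.pt ((c m).pt_dom x h)).2 h
    · exact ((hc h').2.pt hx).1 h
  have Q : ∀ m n x y, x ∈ (c n).dom → y ∈ (c n).dom → (c m).G.inc x y → (c n).G.inc x y := by
    intro m n x y hx hy h
    rcases le_total m n with h' | h'
    · exact (hc h').2.inc' h
    · exact ((hc h').2.inc hx hy).1 h
  refine ⟨c, ⟨fun x => ∃ n, (c n).G.pt x, fun x y => ∃ n, (c n).G.inc x y, ?_, ?_, ?_⟩, hc, ?_, ?_⟩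
  · rintro x y ⟨n, hn⟩
    exact ⟨n, (c n).G.inc_pt x y hn⟩
  · rintro x y ⟨n, hn⟩ ⟨m, hm⟩
    exact (c n).G.inc_ln x y hn (P m n y ((c n).inc_dom _ _ hn).2 hm)
  · rintro p q l m ⟨n1, h1⟩ ⟨n2, h2⟩ ⟨n3, h3⟩ ⟨n4, h4⟩
    have a1 := (hc (le_max_left (max n1 n2) (max n3 n4)))
    have a2 := (hc (le_max_right (max n1 n2) (max n3 n4)))
    have b1 := (hc (le_max_left n1 n2)).trans a1
    have b2 := (hc (le_max_right n1 n2)).trans a1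
    have b3 := (hc (le_max_left n3 n4)).trans a2
    have b4 := (hc (le_max_right n3 n4)).trans a2
    exact Geo.k22 _ p q l m (b1.2.inc' h1) (b2.2.inc' h2) (b3.2.inc' h3) (b4.2.inc' h4)
  · intro n
    refine ⟨fun _ _ _ _ h => h, fun x hx => ⟨?_, fun h => ⟨n, h⟩⟩,
      fun x hx y hy => ⟨?_, fun h => ⟨n, h⟩⟩⟩
    · rintro ⟨m, hm⟩; exact P m n x hx hm
    · rintro ⟨m, hm⟩; exact Q m n x y hx hy hm
  · intro j
    exact ⟨_, Order.sequenceOfCofinals.encode_mem default D j⟩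

/-- The existential-closedness tasks. -/
def ECTask {X : Type u} (e : Cond X) (S : Finset X) (c : Cond X) : Prop :=
  ∃ g : X → X, PEmb e.G c.G ↑e.dom g ∧ (∀ x ∈ e.dom, g x ∈ c.dom) ∧ ∀ x ∈ S, g x = x

theorem generic {X : Type u} [Countable X] [Infinite X] {J : Type*} [Countable J]
    (D : J → Order.Cofinal (Cond X)) :
    ∃ G : Geo X, EC G ∧ ∀ j, ∃ c ∈ D j, Cond.Sub c G := by
  classical
  let E : Cond X × Finset X → Order.Cofinal (Cond X) := fun p =>
    { carrier := {c | p.2 ⊆ c.dom ∧ (ECTask p.1 p.2 c ∨ ∀ d, c ≤ d → ¬ ECTask p.1 p.2 d)}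
      isCofinal := by
        intro c
        obtain ⟨c1, h1, h2⟩ := c.grow p.2
        by_cases h : ∃ d, c1 ≤ d ∧ ECTask p.1 p.2 d
        · obtain ⟨d, hd, hd'⟩ := h
          exact ⟨d, ⟨h2.trans hd.1, Or.inl hd'⟩, h1.trans hd⟩
        · push Not at h
          exact ⟨c1, ⟨h2, Or.inr h⟩, h1⟩ }
  haveI := Cond.countable (X := X)
  obtain ⟨c, G, hc, hG, hD⟩ := generic_aux (Sum.elim D E)
  refine ⟨G, ?_, fun j => ?_⟩
  swap
  · obtain ⟨n, hn⟩ := hD (.inl j)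
    exact ⟨c n, hn, hG n⟩
  intro Y H f hf T hT
  have hfi : Function.Injective f := fun x y h => hf.inj x trivial y trivial h
  haveI : Nonempty Y := ⟨f (Classical.arbitrary X)⟩
  have hS : (f ⁻¹' T).Finite := hT.preimage hfi.injOn
  let S := hS.toFinset
  have hSm : ∀ x, x ∈ S ↔ f x ∈ T := by intro x; simp [S]
  obtain ⟨e, he1, r, hr1, hr2, hr3⟩ := (mkCond G S).push H T hT f
    (PEmb.comp hf (mkCond_sub G S) (fun _ _ => trivial)) (fun x hx => (hSm x).1 hx)
  obtain ⟨n, hn1, hn2⟩ := hD (.inr (e, S))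
  rcases hn2 with ⟨g, hg1, hg2, hg3⟩ | hn2
  · refine ⟨fun y => g (r y), ?_, ?_⟩
    · have h1 : PEmb e.G G ↑e.dom (fun x => id (g x)) :=
        PEmb.comp (hG n) hg1 hg2
      exact h1.comp hr1 (fun x hx => by rw [hr2]; exact ⟨x, hx, rfl⟩)
    · intro s hs
      have hs' := (hSm s).2 hs
      change g (r (f s)) = s
      rw [hr3 s hs', hg3 s hs']
  · exfalso
    obtain ⟨d, hd1, σ, hs1, hs2, hs3⟩ := (c n).push H (T ∪ f '' (c n).dom)
      (hT.union ((c n).dom.finite_toSet.image f)) f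
      (PEmb.comp hf (hG n) (fun _ _ => trivial)) (fun x hx => Or.inr ⟨x, hx, rfl⟩)
    obtain ⟨t, ht1, ht2⟩ := hr1.inv
    refine hn2 d hd1 ⟨fun x => σ (t x), ?_, ?_, ?_⟩
    · change PEmb e.G d.G ↑e.dom _
      rw [hr2]
      refine hs1.comp ht2 ?_
      rintro _ ⟨y, hy, rfl⟩
      rw [ht1 y hy]; exact Or.inl hy
    · intro x hx
      have hx' : x ∈ r '' T := by rw [← hr2]; exact hx
      obtain ⟨y, hy, rfl⟩ := hx'
      change σ (t (r y)) ∈ d.dom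
      rw [ht1 y hy]
      have : σ y ∈ (↑d.dom : Set X) := by rw [hs2]; exact ⟨y, Or.inl hy, rfl⟩
      exact this
    · intro x hx
      have h1 := ht1 (f x) ((hSm x).1 hx)
      rw [hr3 x hx] at h1
      change σ (t x) = x
      rw [h1]
      exact hs3 x (hn1 hx)


theorem EC.nonempty {N : Type u} {G : Geo N} (hG : EC G) : Nonempty N := by
  by_contra hN
  rw [not_nonempty_iff] at hN
  obtain ⟨g, -⟩ := hG PUnit ⟨fun _ => True, fun _ _ => False, by simp, by simp, by simp⟩
    (fun n => hN.elim n) ⟨fun n => hN.elim n, fun n => hN.elim n, fun n => hN.elim n⟩ ∅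
    Set.finite_empty
  exact hN.elim (g PUnit.unit)

/-- Property (2), combinatorially. -/
def FinP : Prop := ∀ (A : Type u) (G : Geo A), Finite A →
  ∃ (B : Type u) (H : Geo B) (f : A → B), Finite B ∧ Plane H ∧ Emb G H f

/-- The condition is a projective plane on its domain. -/
def Cond.IsPl {X : Type u} (c : Cond X) : Prop :=
  (∀ x ∈ c.dom, ∀ y ∈ c.dom, c.G.pt x → c.G.pt y → x ≠ y → ∃ z, c.G.inc x z ∧ c.G.inc y z) ∧
  (∀ x ∈ c.dom, ∀ y ∈ c.dom, ¬ c.G.pt x → ¬ c.G.pt y → x ≠ y → ∃ z, c.G.inc z x ∧ c.G.inc z y)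

theorem FinP.cofinal (h : FinP.{u}) {X : Type u} [Infinite X] (F : Finset X) (c : Cond X) :
    ∃ d, c ≤ d ∧ F ⊆ d.dom ∧ d.IsPl := by
  classical
  let x0 : X := Classical.arbitrary X
  obtain ⟨c1, h1, h2⟩ := c.grow (insert x0 F)
  let A := {x : X // x ∈ c1.dom}
  let GA : Geo A :=
    { pt := fun x => c1.G.pt x
      inc := fun x y => c1.G.inc x y
      inc_pt := fun x y => c1.G.inc_pt x y
      inc_ln := fun x y => c1.G.inc_ln x y
      k22 := fun p q l m a1 a2 a3 a4 => by
        rcases c1.G.k22 p q l m a1 a2 a3 a4 with h | h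
        · exact Or.inl (Subtype.ext h)
        · exact Or.inr (Subtype.ext h) }
  obtain ⟨B, H, f, hB, hH, hf⟩ := h A GA inferInstance
  let a0 : A := ⟨x0, h2 (Finset.mem_insert_self _ _)⟩
  let f' : X → B := fun x => if hx : x ∈ c1.dom then f ⟨x, hx⟩ else f a0
  have e : ∀ x (hx : x ∈ c1.dom), f' x = f ⟨x, hx⟩ := fun x hx => by simp [f', hx]
  have hf' : PEmb c1.G H ↑c1.dom f' := by
    refine ⟨fun x hx y hy hxy => ?_, fun x hx => ?_, fun x hx y hy => ?_⟩
    · rw [e x hx, e y hy] at hxy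
      exact congrArg Subtype.val (hf.inj _ trivial _ trivial hxy)
    · rw [e x hx]; exact hf.pt ⟨x, hx⟩ trivial
    · rw [e x hx, e y hy]; exact hf.inc ⟨x, hx⟩ trivial ⟨y, hy⟩ trivial
  obtain ⟨d, hd1, r, hd2, hd3, hd4⟩ := c1.push H Set.univ Set.finite_univ f' hf' (by simp)
  refine ⟨d, h1.trans hd1, (Finset.subset_insert _ _).trans (h2.trans hd1.1), ?_, ?_⟩
  · intro x hx y hy px py hxy
    have hx' : x ∈ r '' Set.univ := by rw [← hd3]; exact hx
    have hy' : y ∈ r '' Set.univ := by rw [← hd3]; exact hy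
    obtain ⟨a, -, rfl⟩ := hx'
    obtain ⟨b, -, rfl⟩ := hy'
    obtain ⟨z, hz⟩ := hH.1 a b ((hd2.pt a trivial).1 px) ((hd2.pt b trivial).1 py)
      (fun h => hxy (by rw [h]))
    exact ⟨r z, (hd2.inc a trivial z trivial).2 hz.1, (hd2.inc b trivial z trivial).2 hz.2⟩
  · intro x hx y hy px py hxy
    have hx' : x ∈ r '' Set.univ := by rw [← hd3]; exact hx
    have hy' : y ∈ r '' Set.univ := by rw [← hd3]; exact hy
    obtain ⟨a, -, rfl⟩ := hx'
    obtain ⟨b, -, rfl⟩ := hy'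
    obtain ⟨z, hz⟩ := hH.2 a b (fun h => px ((hd2.pt a trivial).2 h))
      (fun h => py ((hd2.pt b trivial).2 h)) (fun h => hxy (by rw [h]))
    exact ⟨r z, (hd2.inc z trivial a trivial).2 hz.1, (hd2.inc z trivial b trivial).2 hz.2⟩

/-- Closed finite partial embeddings. -/
structure PE {X N : Type u} (G : Geo X) (GN : Geo N) where
  E : Finset X
  g : X → N
  cl : ∀ x ∈ E, ∀ y ∈ E, x ≠ y → ∀ z, (G.inc x z ∧ G.inc y z) ∨ (G.inc z x ∧ G.inc z y) → z ∈ E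
  emb : PEmb G GN ↑E g

instance {X N : Type u} (G : Geo X) (GN : Geo N) : Preorder (PE G GN) where
  le p q := p.E ⊆ q.E ∧ ∀ x ∈ p.E, q.g x = p.g x
  le_refl p := ⟨subset_rfl, fun _ _ => rfl⟩
  le_trans p q r h1 h2 := ⟨h1.1.trans h2.1, fun x hx => (h2.2 x (h1.1 hx)).trans (h1.2 x hx)⟩

theorem FinP.prime (h : FinP.{u}) {X : Type u} [Countable X] [Infinite X] :
    ∃ G : Geo X, EC G ∧ ∀ (N : Type u) (GN : Geo N), EC GN → ∃ f : X → N, Emb G GN f := by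
  classical
  obtain ⟨G, hG, hD⟩ := generic (X := X) (J := Finset X) (fun F =>
    { carrier := {c | F ⊆ c.dom ∧ c.IsPl}
      isCofinal := fun c => by
        obtain ⟨d, h1, h2⟩ := h.cofinal F c
        exact ⟨d, h2, h1⟩ })
  refine ⟨G, hG, fun N GN hN => ?_⟩
  haveI := Encodable.ofCountable X
  obtain ⟨n0⟩ := hN.nonempty
  let p0 : PE G GN := ⟨∅, fun _ => n0, by simp, ⟨by simp, by simp, by simp⟩⟩
  let D : X → Order.Cofinal (PE G GN) := fun x =>
    { carrier := {p | x ∈ p.E}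
      isCofinal := by
        intro p
        obtain ⟨c, ⟨hc1, hc2⟩, hc3⟩ := hD (insert x p.E)
        have hp : p.E ⊆ c.dom := (Finset.subset_insert _ _).trans hc1
        obtain ⟨g, hg1, hg2⟩ := hN.extend G ↑c.dom ↑p.E p.g c.dom.finite_toSet
          (fun x hx => hp hx) p.emb
          (fun a ha b hb hab l hl hl' i1 i2 _ _ _ => hl' (p.cl a ha b hb hab l (Or.inl ⟨i1, i2⟩)))
          (fun a ha b hb hab l hl hl' i1 i2 _ _ _ => hl' (p.cl a ha b hb hab l (Or.inr ⟨i1, i2⟩)))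
        refine ⟨⟨c.dom, g, ?_, hg1⟩, hc1 (Finset.mem_insert_self _ _), hp, fun x hx => hg2 x hx⟩
        intro a ha b hb hab z hz
        by_cases hpa : c.G.pt a
        · have hpa' := (hc3.pt ha).2 hpa
          have hz' : G.inc a z ∧ G.inc b z := by
            rcases hz with hz | hz
            · exact hz
            · exact absurd hpa' (G.inc_ln _ _ hz.1)
          have hpb : c.G.pt b := (hc3.pt hb).1 (G.inc_pt _ _ hz'.2)
          obtain ⟨w, hw1, hw2⟩ := hc2.1 a ha b hb hpa hpb hab
          rcases G.k22 a b z w hz'.1 hz'.2 (hc3.inc' hw1) (hc3.inc' hw2) with h | h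
          · exact absurd h hab
          · rw [h]; exact (c.inc_dom _ _ hw1).2
        · have hpa' := fun h => hpa ((hc3.pt ha).1 h)
          have hz' : G.inc z a ∧ G.inc z b := by
            rcases hz with hz | hz
            · exact absurd (G.inc_pt _ _ hz.1) hpa'
            · exact hz
          have hpb : ¬ c.G.pt b := fun h => G.inc_ln _ _ hz'.2 ((hc3.pt hb).2 h)
          obtain ⟨w, hw1, hw2⟩ := hc2.2 a ha b hb hpa hpb hab
          rcases G.k22 z w a b hz'.1 (hc3.inc' hw1) hz'.2 (hc3.inc' hw2) with h | h
          · rw [h]; exact (c.inc_dom _ _ hw1).1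
          · exact absurd h hab }
  let q : ℕ → PE G GN := Order.sequenceOfCofinals p0 D
  have hq : Monotone q := Order.sequenceOfCofinals.monotone _ _
  have hm : ∀ x, ∃ n, x ∈ (q n).E := fun x => ⟨_, Order.sequenceOfCofinals.encode_mem p0 D x⟩
  choose n hn using hm
  have e : ∀ x m, n x ≤ m → (q m).g x = (q (n x)).g x := fun x m hm => (hq hm).2 x (hn x)
  have e' : ∀ x m, n x ≤ m → x ∈ (q m).E := fun x m hm => (hq hm).1 (hn x)
  refine ⟨fun x => (q (n x)).g x, fun x _ y _ hxy => ?_, fun x _ => ?_, fun x _ y _ => ?_⟩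
  · have h1 := le_max_left (n x) (n y)
    have h2 := le_max_right (n x) (n y)
    simp only [← e x _ h1, ← e y _ h2] at hxy
    exact (q _).emb.inj _ (e' x _ h1) _ (e' y _ h2) hxy
  · exact (q _).emb.pt _ (hn x)
  · have h1 := le_max_left (n x) (n y)
    have h2 := le_max_right (n x) (n y)
    simp only [← e x _ h1, ← e y _ h2]
    exact (q _).emb.inc _ (e' x _ h1) _ (e' y _ h2)


/-- Six lines in general position. -/
structure Hex {X : Type*} (w : Fin 6 → X) (P : Fin 6 → Fin 6 → X) (G : Geo X) : Prop where
  inj : ∀ i j, w i = w j → i = j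
  inc : ∀ i j k, i ≠ j → (G.inc (P i j) (w k) ↔ k = i ∨ k = j)

theorem exists_hex {M : Type u} {G : Geo M} (hG : EC G) : ∃ w P, Hex w P G := by
  let K0 : Geo (Fin 6 ⊕ (Fin 6 × Fin 6)) :=
    { pt := fun x => ∃ a, x = .inr a
      inc := fun x y => ∃ a k, x = .inr a ∧ y = .inl k ∧ a.1 < a.2 ∧ (k = a.1 ∨ k = a.2)
      inc_pt := by grind
      inc_ln := by grind
      k22 := by
        rintro _ _ _ _ ⟨⟨a, b⟩, k, rfl, rfl, h1, h2⟩ ⟨⟨a', b'⟩, k', rfl, e, h3, h4⟩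
          ⟨⟨a1, b1⟩, k1, e1, rfl, h5, h6⟩ ⟨⟨a2, b2⟩, k2, e2, e3, h7, h8⟩
        simp only [Sum.inl.injEq, Sum.inr.injEq, Prod.mk.injEq] at *
        omega }
  let K : Geo (ULift.{u} (Fin 6 ⊕ (Fin 6 × Fin 6))) :=
    { pt := fun x => K0.pt x.down
      inc := fun x y => K0.inc x.down y.down
      inc_pt := fun x y => K0.inc_pt _ _
      inc_ln := fun x y => K0.inc_ln _ _
      k22 := fun p q l m a1 a2 a3 a4 => by
        rcases K0.k22 _ _ _ _ a1 a2 a3 a4 with h | h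
        · exact Or.inl (ULift.ext _ _ h)
        · exact Or.inr (ULift.ext _ _ h) }
  obtain ⟨m0⟩ := hG.nonempty
  obtain ⟨g, hg, -⟩ := hG.extend K Set.univ ∅ (fun _ => m0) Set.finite_univ (by simp)
    ⟨by simp, by simp, by simp⟩ (by simp) (by simp)
  refine ⟨fun i => g ⟨.inl i⟩, fun i j => g ⟨.inr (min i j, max i j)⟩, ?_, ?_⟩
  · intro i j h
    have := hg.inj _ trivial _ trivial h
    simpa using this
  · intro i j k hij
    rw [hg.inc _ trivial _ trivial]
    simp only [K, K0]
    constructor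
    · rintro ⟨a, k', h1, h2, h3, h4⟩
      simp only [Sum.inl.injEq, Sum.inr.injEq] at h1 h2
      subst h1 h2
      simp only at h4
      rcases le_total i j with h | h <;> simp [h] at h4 <;> tauto
    · intro h
      refine ⟨_, _, rfl, rfl, by simpa [eq_comm] using hij, ?_⟩
      simp only
      rcases le_total i j with h' | h' <;> simp [h'] <;> tauto

theorem Hex.map {X Y : Type*} {w : Fin 6 → X} {P : Fin 6 → Fin 6 → X} {G : Geo X} (h : Hex w P G)
    {H : Geo Y} {T : Set X} {g : X → Y} (hg : PEmb G H T g) (h1 : ∀ i, w i ∈ T)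
    (h2 : ∀ i j, P i j ∈ T) : Hex (fun i => g (w i)) (fun i j => g (P i j)) H :=
  ⟨fun i j e => h.inj _ _ (hg.inj _ (h1 i) _ (h1 j) e),
    fun i j k hij => (hg.inc _ (h2 i j) _ (h1 k)).trans (h.inc i j k hij)⟩

theorem Hex.card {X : Type*} {w : Fin 6 → X} {P : Fin 6 → Fin 6 → X} {G : Geo X} (h : Hex w P G)
    (p : X) (B : Finset (Fin 6)) (hB : ∀ i ∈ B, G.inc p (w i)) : B.card ≤ 2 := by
  by_contra hcon
  push Not at hcon
  obtain ⟨a, ha, b, hb, c, hc, hab, hac, hbc⟩ := Finset.two_lt_card.1 hcon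
  rcases G.k22 p (P a b) (w a) (w b) (hB a ha) ((h.inc a b a hab).2 (Or.inl rfl)) (hB b hb)
    ((h.inc a b b hab).2 (Or.inr rfl)) with e | e
  · have := hB c hc
    rw [e, h.inc a b c hab] at this
    grind
  · exact hab (h.inj _ _ e)

theorem Hex.pick {X : Type*} {w : Fin 6 → X} {P : Fin 6 → Fin 6 → X} {G : Geo X} (h : Hex w P G)
    (p q : X) : ∃ i1 i2 i3 i4 : Fin 6, i1 ≠ i2 ∧ i1 ≠ i3 ∧ i1 ≠ i4 ∧ i2 ≠ i3 ∧ i2 ≠ i4 ∧ i3 ≠ i4 ∧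
      ¬ G.inc p (w i1) ∧ ¬ G.inc p (w i2) ∧ ¬ G.inc q (w i1) ∧ ¬ G.inc q (w i2) := by
  classical
  let B1 := Finset.univ.filter (fun i => G.inc p (w i))
  let B2 := Finset.univ.filter (fun i => G.inc q (w i))
  have h1 : B1.card ≤ 2 := h.card p B1 (fun i hi => (Finset.mem_filter.1 hi).2)
  have h2 : B2.card ≤ 2 := h.card q B2 (fun i hi => (Finset.mem_filter.1 hi).2)
  have h3 : 1 < ((B1 ∪ B2)ᶜ).card := by
    have := Finset.card_union_le B1 B2
    rw [Finset.card_compl, Fintype.card_fin]; omega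
  obtain ⟨i1, hi1, i2, hi2, h12⟩ := Finset.one_lt_card.1 h3
  have h4 : 1 < (({i1, i2} : Finset (Fin 6))ᶜ).card := by
    have := Finset.card_le_two (a := i1) (b := i2)
    rw [Finset.card_compl, Fintype.card_fin]; omega
  obtain ⟨i3, hi3, i4, hi4, h34⟩ := Finset.one_lt_card.1 h4
  simp only [Finset.mem_compl, Finset.mem_union, Finset.mem_insert, Finset.mem_singleton,
    not_or, B1, B2, Finset.mem_filter, Finset.mem_univ, true_and] at *
  refine ⟨i1, i2, i3, i4, h12, ?_, ?_, ?_, ?_, h34, hi1.1, hi2.1, hi1.2, hi2.2⟩ <;> grind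

theorem Hex.pick_point {X : Type*} {w : Fin 6 → X} {P : Fin 6 → Fin 6 → X} {G : Geo X}
    (h : Hex w P G) (l m : X) : ∃ i j, i ≠ j ∧ ¬ G.inc (P i j) l ∧ ¬ G.inc (P i j) m := by
  classical
  let C1 := Finset.univ.filter (fun i => w i = l)
  let C2 := Finset.univ.filter (fun i => w i = m)
  have h1 : C1.card ≤ 1 := Finset.card_le_one.2 (by
    intro a ha b hb
    exact h.inj _ _ ((Finset.mem_filter.1 ha).2.trans (Finset.mem_filter.1 hb).2.symm))
  have h2 : C2.card ≤ 1 := Finset.card_le_one.2 (by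
    intro a ha b hb
    exact h.inj _ _ ((Finset.mem_filter.1 ha).2.trans (Finset.mem_filter.1 hb).2.symm))
  have h3 : 0 < ((C1 ∪ C2)ᶜ).card := by
    have := Finset.card_union_le C1 C2
    rw [Finset.card_compl, Fintype.card_fin]; omega
  obtain ⟨i, hi⟩ := Finset.card_pos.1 h3
  have key : ∀ n, w i ≠ n → ({j | j ≠ i ∧ G.inc (P i j) n} : Finset (Fin 6)).card ≤ 1 := by
    intro n hn
    refine Finset.card_le_one.2 ?_
    intro a ha b hb
    simp only [Finset.mem_filter, Finset.mem_univ, true_and] at ha hb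
    by_contra hab
    rcases G.k22 (P i a) (P i b) (w i) n ((h.inc i a i ha.1.symm).2 (Or.inl rfl))
      ((h.inc i b i hb.1.symm).2 (Or.inl rfl)) ha.2 hb.2 with e | e
    · have := (h.inc i a a ha.1.symm).2 (Or.inr rfl)
      rw [e, h.inc i b a hb.1.symm] at this
      grind
    · exact hn e
  simp only [Finset.mem_compl, Finset.mem_union, not_or, C1, C2, Finset.mem_filter,
    Finset.mem_univ, true_and] at hi
  have k1 := key l hi.1
  have k2 := key m hi.2
  set E1 : Finset (Fin 6) := {j | j ≠ i ∧ G.inc (P i j) l} with hE1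
  set E2 : Finset (Fin 6) := {j | j ≠ i ∧ G.inc (P i j) m} with hE2
  have h4 : 0 < ((insert i (E1 ∪ E2))ᶜ).card := by
    have := Finset.card_union_le E1 E2
    have := Finset.card_insert_le i (E1 ∪ E2)
    rw [Finset.card_compl, Fintype.card_fin]; omega
  obtain ⟨j, hj⟩ := Finset.card_pos.1 h4
  simp only [Finset.mem_compl, Finset.mem_insert, Finset.mem_union, not_or, hE1, hE2,
    Finset.mem_filter, Finset.mem_univ, true_and, not_and] at hj
  exact ⟨i, j, fun e => hj.1 e.symm, hj.2.1 hj.1, hj.2.2 hj.1⟩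

/-- Adding a line through two points. -/
theorem Cond.addLine {X : Type u} [Infinite X] (c : Cond X) (p q : X) (hp : c.G.pt p)
    (hq : c.G.pt q) (hno : ∀ z, c.G.inc p z → c.G.inc q z → False) :
    ∃ d l, c ≤ d ∧ l ∉ c.dom ∧ l ∈ d.dom ∧ ¬ d.G.pt l ∧
      ∀ x y, d.G.inc x y ↔ c.G.inc x y ∨ (y = l ∧ (x = p ∨ x = q)) := by
  obtain ⟨d, v, h1, h2, h3, h4, -, h6⟩ := c.add False {p, q}
    (by rintro x (rfl | rfl); exacts [c.pt_dom _ hp, c.pt_dom _ hq])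
    (by rintro x (rfl | rfl) <;> simpa)
    (by
      rintro x (rfl | rfl) y (rfl | rfl) hxy z hz hz'
      · exact hxy rfl
      · exact hno z hz hz'
      · exact hno z hz' hz
      · exact hxy rfl)
    (by
      rintro x (rfl | rfl) y _ _ z hz _
      · exact c.G.inc_ln _ _ hz hp
      · exact c.G.inc_ln _ _ hz hq)
  exact ⟨d, v, h1, h2, h3, by simpa using h4, by simpa using h6⟩

/-- Adding a point on several lines. -/
theorem Cond.addPoint {X : Type u} [Infinite X] (c : Cond X) (S : Set X)
    (hS : ∀ x ∈ S, x ∈ c.dom ∧ ¬ c.G.pt x)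
    (hno : ∀ x ∈ S, ∀ y ∈ S, x ≠ y → ∀ z, c.G.inc z x → c.G.inc z y → False) :
    ∃ d v, c ≤ d ∧ v ∉ c.dom ∧ v ∈ d.dom ∧ d.G.pt v ∧
      ∀ x y, d.G.inc x y ↔ c.G.inc x y ∨ (x = v ∧ y ∈ S) := by
  obtain ⟨d, v, h1, h2, h3, h4, -, h6⟩ := c.add True S (fun x hx => (hS x hx).1)
    (fun x hx => by simpa using (hS x hx).2)
    (fun x hx y hy _ z hz _ => (hS x hx).2 (c.G.inc_pt _ _ hz)) hno
  exact ⟨d, v, h1, h2, h3, by simpa using h4, by simpa using h6⟩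

/-- Witnesses over a condition. -/
def Wit {X M : Type u} (GM : Geo M) (R : (M → X) → Prop) (d : Cond X) (G : Geo X) (f : M → X) :
    Prop := Plane G ∧ d.Sub G ∧ Emb GM G f ∧ R f

theorem Wit.mono {X M : Type u} {GM : Geo M} {R : (M → X) → Prop} {c d : Cond X} {G : Geo X}
    {f : M → X} (h : Wit GM R d G f) (hcd : c ≤ d) : Wit GM R c G f :=
  ⟨h.1, Cond.Sub.of_le hcd h.2.1, h.2.2⟩

/-- Elements of a condition forced to be the image of a fixed element of `M`. -/
def Df {X M : Type u} (GM : Geo M) (R : (M → X) → Prop) (d : Cond X) (x : X) : Prop :=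
  x ∈ d.dom ∧ ∃ m, ∀ G f, Wit GM R d G f → f m = x

theorem Df.mono {X M : Type u} {GM : Geo M} {R : (M → X) → Prop} {c d : Cond X} {x : X}
    (h : Df GM R c x) (hcd : c ≤ d) : Df GM R d x := by
  obtain ⟨h1, m, hm⟩ := h
  exact ⟨hcd.1 h1, m, fun G f hf => hm G f (hf.mono hcd)⟩

theorem Df.op {X M : Type u} {GM : Geo M} (hM : Plane GM) {R : (M → X) → Prop} {d : Cond X}
    {x y z : X} (hx : Df GM R d x) (hy : Df GM R d y) (hxy : x ≠ y)
    (h : (d.G.inc x z ∧ d.G.inc y z) ∨ (d.G.inc z x ∧ d.G.inc z y)) : Df GM R d z := by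
  obtain ⟨h1, m, hm⟩ := hx
  obtain ⟨h2, n, hn⟩ := hy
  refine ⟨?_, GM.op m n, fun G f hf => ?_⟩
  · rcases h with h | h
    · exact (d.inc_dom _ _ h.1).2
    · exact (d.inc_dom _ _ h.1).1
  · rw [← Geo.op_map hM hf.2.2.1 trivial trivial trivial, hm G f hf, hn G f hf]
    apply G.op_eq hxy
    rcases h with h | h
    · exact Or.inl ⟨hf.2.1.inc' h.1, hf.2.1.inc' h.2⟩
    · exact Or.inr ⟨hf.2.1.inc' h.1, hf.2.1.inc' h.2⟩

theorem decide_z {X M : Type u} [Infinite X] {GM : Geo M} (hM : Plane GM) {R : (M → X) → Prop}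
    {d : Cond X} (hW : ∀ d', d ≤ d' → ∃ G f, Wit GM R d' G f) {k1 k2 n : X}
    (h1 : Df GM R d k1) (h2 : Df GM R d k2) (h3 : Df GM R d n)
    (p1 : ¬ d.G.pt k1) (p2 : ¬ d.G.pt k2) (p3 : ¬ d.G.pt n)
    (n1 : k1 ≠ k2) (n2 : n ≠ k1) (n3 : n ≠ k2)
    (e1 : ∀ z, d.G.inc z k1 → d.G.inc z k2 → False)
    (e2 : ∀ z, d.G.inc z k1 → d.G.inc z n → False)
    (e3 : ∀ z, d.G.inc z k2 → d.G.inc z n → False) : False := by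
  obtain ⟨a1, m1, b1⟩ := h1
  obtain ⟨a2, m2, b2⟩ := h2
  obtain ⟨a3, m3, b3⟩ := h3
  obtain ⟨d', z, c1, c2, c3, c4, c5⟩ := d.addPoint
    {x | x = k1 ∨ x = k2 ∨ (x = n ∧ ¬ GM.inc (GM.op m1 m2) m3)}
    (by rintro x (rfl | rfl | ⟨rfl, -⟩) <;> simp [*])
    (by
      rintro x (rfl | rfl | ⟨rfl, -⟩) y (rfl | rfl | ⟨rfl, -⟩) hxy t ht ht'
      · exact hxy rfl
      · exact e1 t ht ht'
      · exact e2 t ht ht'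
      · exact e1 t ht' ht
      · exact hxy rfl
      · exact e3 t ht ht'
      · exact e2 t ht' ht
      · exact e3 t ht' ht
      · exact hxy rfl)
  obtain ⟨G, f, hf⟩ := hW d' c1
  have hf' := hf.mono c1
  have q1 := b1 G f hf'
  have q2 := b2 G f hf'
  have q3 := b3 G f hf'
  have i1 : d'.G.inc z k1 := (c5 z k1).2 (Or.inr ⟨rfl, Or.inl rfl⟩)
  have i2 : d'.G.inc z k2 := (c5 z k2).2 (Or.inr ⟨rfl, Or.inr (Or.inl rfl)⟩)
  have hz : f (GM.op m1 m2) = z := by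
    rw [← Geo.op_map hM hf.2.2.1 trivial trivial trivial, q1, q2]
    exact G.op_eq n1 (Or.inr ⟨hf.2.1.inc' i1, hf.2.1.inc' i2⟩)
  have r1 : G.inc z n ↔ GM.inc (GM.op m1 m2) m3 := by
    rw [← hz, ← q3]; exact hf.2.2.1.inc _ trivial _ trivial
  have r2 : G.inc z n ↔ d'.G.inc z n := hf.2.1.inc c3 (c1.1 a3)
  have r3 : d'.G.inc z n ↔ ¬ GM.inc (GM.op m1 m2) m3 := by
    rw [c5]
    have : ¬ d.G.inc z n := fun h => c2 (d.inc_dom _ _ h).1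
    simp [this, n2, n3]
  tauto

theorem no_points {X M : Type u} [Infinite X] {GM : Geo M} (hM : Plane GM) {R : (M → X) → Prop}
    {d : Cond X} (hW : ∀ d', d ≤ d' → ∃ G f, Wit GM R d' G f) {w : Fin 6 → X}
    {P : Fin 6 → Fin 6 → X} (hH : Hex w P d.G) (hw : ∀ i, Df GM R d (w i))
    (hP : ∀ i j, Df GM R d (P i j)) {p q : X} (hp : Df GM R d p) (hq : Df GM R d q)
    (pp : d.G.pt p) (pq : d.G.pt q) (hpq : p ≠ q)
    (hno : ∀ z, d.G.inc p z → d.G.inc q z → False) : False := by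
  obtain ⟨i1, i2, i3, i4, n12, n13, n14, n23, n24, n34, g1, g2, g3, g4⟩ := hH.pick p q
  have hI := hH.inc
  have hJ := hH.inj
  have y1p : d.G.pt (P i2 i3) := d.G.inc_pt _ _ ((hI i2 i3 i2 n23).2 (Or.inl rfl))
  have y2p : d.G.pt (P i1 i3) := d.G.inc_pt _ _ ((hI i1 i3 i1 n13).2 (Or.inl rfl))
  have y1a : ¬ d.G.inc (P i2 i3) (w i1) := by rw [hI _ _ _ n23]; clear * - n12 n13 n14 n23 n24 n34; grind
  have y1b : d.G.inc (P i2 i3) (w i2) := by rw [hI _ _ _ n23]; clear * - n12 n13 n14 n23 n24 n34; grind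
  have y1c : ¬ d.G.inc (P i2 i3) (w i4) := by rw [hI _ _ _ n23]; clear * - n12 n13 n14 n23 n24 n34; grind
  have y2a : d.G.inc (P i1 i3) (w i1) := by rw [hI _ _ _ n13]; clear * - n12 n13 n14 n23 n24 n34; grind
  have y2b : ¬ d.G.inc (P i1 i3) (w i2) := by rw [hI _ _ _ n13]; clear * - n12 n13 n14 n23 n24 n34; grind
  have y2c : ¬ d.G.inc (P i1 i3) (w i4) := by rw [hI _ _ _ n13]; clear * - n12 n13 n14 n23 n24 n34; grind
  have m1l : ¬ d.G.pt (w i1) := d.G.inc_ln _ _ y2a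
  have m2l : ¬ d.G.pt (w i2) := d.G.inc_ln _ _ y1b
  have nl : ¬ d.G.pt (w i4) := d.G.inc_ln _ _ ((hI i4 i1 i4 n14.symm).2 (Or.inl rfl))
  have w12 : w i1 ≠ w i2 := fun h => n12 (hJ _ _ h)
  have w14 : w i1 ≠ w i4 := fun h => n14 (hJ _ _ h)
  have w24 : w i2 ≠ w i4 := fun h => n24 (hJ _ _ h)
  have y1D := hP i2 i3
  have y2D := hP i1 i3
  have m1D := hw i1
  have m2D := hw i2
  have nD := hw i4
  generalize P i2 i3 = y1 at *
  generalize P i1 i3 = y2 at *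
  generalize w i1 = m1 at *
  generalize w i2 = m2 at *
  generalize w i4 = n at *
  clear hI hJ hH hw hP
  have y1d := y1D.1
  have y2d := y2D.1
  have m1d := m1D.1
  have m2d := m2D.1
  have nd := nD.1
  have pd := hp.1
  have qd := hq.1
  have D0 := d.inc_dom
  -- the line l
  obtain ⟨d1, l, le1, l0, l1, lp, I1⟩ := d.addLine p q pp pq hno
  have D1 := d1.inc_dom
  have pt1 : ∀ x ∈ d.dom, (d1.G.pt x ↔ d.G.pt x) := fun x hx => le1.2.pt hx
  have s1 := le1.1
  have nl' : ∀ x ∈ d.dom, x ≠ l := fun x hx h => l0 (h ▸ hx)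
  have F3 : ∀ y, ¬ d.G.inc y l := fun y h => l0 (D0 _ _ h).2
  have m1l' := nl' _ m1d
  have m2l' := nl' _ m2d
  have nnl' := nl' _ nd
  -- the point x1
  obtain ⟨d2, x1, le2, x10, x11, x1p, I2⟩ := d1.addPoint {l, m1}
    (by rintro x (rfl | rfl); exacts [⟨l1, lp⟩, ⟨s1 m1d, by rwa [pt1 _ m1d]⟩])
    (by
      have key : ∀ z, d1.G.inc z l → d1.G.inc z m1 → False := by
        intro z h1 h2
        rw [I1] at h1 h2
        clear * - h1 h2 F3 m1l' g1 g3
        grind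
      rintro x (rfl | rfl) y (rfl | rfl) hxy z hz hz'
      · exact hxy rfl
      · exact key z hz hz'
      · exact key z hz' hz
      · exact hxy rfl)
  have D2 := d2.inc_dom
  have pt2 : ∀ x ∈ d1.dom, (d2.G.pt x ↔ d1.G.pt x) := fun x hx => le2.2.pt hx
  have s2 := le2.1
  have nx1 : ∀ x ∈ d.dom, x ≠ x1 := fun x hx h => x10 (h ▸ s1 hx)
  have F1 : ∀ y, ¬ d.G.inc x1 y := fun y h => x10 (s1 (D0 _ _ h).1)
  have px1 := nx1 _ pd
  have qx1 := nx1 _ qd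
  have y1x1 := nx1 _ y1d
  have y2x1 := nx1 _ y2d
  -- the point x2
  obtain ⟨d3, x2, le3, x20, x21, x2p, I3⟩ := d2.addPoint {l, m2}
    (by
      rintro x (rfl | rfl)
      exacts [⟨s2 l1, by rwa [pt2 _ l1]⟩, ⟨s2 (s1 m2d), by rwa [pt2 _ (s1 m2d), pt1 _ m2d]⟩])
    (by
      have key : ∀ z, d2.G.inc z l → d2.G.inc z m2 → False := by
        intro z h1 h2
        rw [I2, I1] at h1 h2
        simp only [Set.mem_insert_iff, Set.mem_singleton_iff] at h1 h2
        clear * - h1 h2 F3 F1 m2l' w12 g2 g4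
        grind
      rintro x (rfl | rfl) y (rfl | rfl) hxy z hz hz'
      · exact hxy rfl
      · exact key z hz hz'
      · exact key z hz' hz
      · exact hxy rfl)
  have D3 := d3.inc_dom
  have pt3 : ∀ x ∈ d2.dom, (d3.G.pt x ↔ d2.G.pt x) := fun x hx => le3.2.pt hx
  have s3 := le3.1
  simp only [Set.mem_insert_iff, Set.mem_singleton_iff] at I2 I3
  -- the line k1
  have y1p3 : d3.G.pt y1 := by rwa [pt3 _ (s2 (s1 y1d)), pt2 _ (s1 y1d), pt1 _ y1d]
  have y2p3 : d3.G.pt y2 := by rwa [pt3 _ (s2 (s1 y2d)), pt2 _ (s1 y2d), pt1 _ y2d]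
  have ny1p : y1 ≠ p := by rintro rfl; exact g2 y1b
  have ny1q : y1 ≠ q := by rintro rfl; exact g4 y1b
  have ny2p : y2 ≠ p := by rintro rfl; exact g1 y2a
  have ny2q : y2 ≠ q := by rintro rfl; exact g3 y2a
  have ny12 : y1 ≠ y2 := by rintro rfl; exact y1a y2a
  have nx2 : ∀ x ∈ d.dom, x ≠ x2 := fun x hx h => x20 (h ▸ s2 (s1 hx))
  have px2 := nx2 _ pd
  have qx2 := nx2 _ qd
  have y1x2 := nx2 _ y1d
  have y2x2 := nx2 _ y2d
  have nx12 : x1 ≠ x2 := fun h => x20 (h ▸ x11)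
  have nlx1 : l ≠ x1 := fun h => x10 (h ▸ l1)
  have nlx2 : l ≠ x2 := fun h => x20 (h ▸ s2 l1)
  have J3 : ∀ x y, d3.G.inc x y ↔ d.G.inc x y ∨ (y = l ∧ (x = p ∨ x = q)) ∨
      (x = x1 ∧ (y = l ∨ y = m1)) ∨ (x = x2 ∧ (y = l ∨ y = m2)) := by
    intro x y
    rw [I3, I2, I1]
    clear * -
    tauto
  have F2 : ∀ y, ¬ d.G.inc x2 y := fun y h => x20 (s2 (s1 (D0 _ _ h).1))
  obtain ⟨d4, k1, le4, k10, k11, k1p, I4⟩ := d3.addLine x1 y1 (by rwa [pt3 _ x11]) y1p3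
    (by
      intro z h1 h2
      rw [J3] at h1 h2
      clear * - h1 h2 F1 F3 nx12 ny1p ny1q y1a y1x1 y1x2 px1 qx1
      grind)
  have D4 := d4.inc_dom
  have pt4 : ∀ x ∈ d3.dom, (d4.G.pt x ↔ d3.G.pt x) := fun x hx => le4.2.pt hx
  have s4 := le4.1
  have F4 : ∀ y, ¬ d.G.inc y k1 := fun y h => k10 (s3 (s2 (s1 (D0 _ _ h).2)))
  have nk1 : ∀ x ∈ d.dom, x ≠ k1 := fun x hx h => k10 (h ▸ s3 (s2 (s1 hx)))
  have m1k1 := nk1 _ m1d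
  have m2k1 := nk1 _ m2d
  have nk1' := nk1 _ nd
  have nlk1 : l ≠ k1 := fun h => k10 (h ▸ s3 (s2 l1))
  obtain ⟨d5, k2, le5, k20, k21, k2p, I5⟩ := d4.addLine x2 y2 (by rwa [pt4 _ x21])
    (by rwa [pt4 _ (s3 (s2 (s1 y2d)))])
    (by
      intro z h1 h2
      rw [I4, J3] at h1 h2
      clear * - h1 h2 F2 F3 F4 nx12 ny2p ny2q ny12 y2b y1x2 y2x1 y2x2 px2 qx2 nlk1 m2k1
      grind)
  have pt5 : ∀ x ∈ d4.dom, (d5.G.pt x ↔ d4.G.pt x) := fun x hx => le5.2.pt hx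
  have s5 := le5.1
  have F5 : ∀ y, ¬ d.G.inc y k2 := fun y h => k20 (s4 (s3 (s2 (s1 (D0 _ _ h).2))))
  have nk2 : ∀ x ∈ d.dom, x ≠ k2 := fun x hx h => k20 (h ▸ s4 (s3 (s2 (s1 hx))))
  have m1k2 := nk2 _ m1d
  have m2k2 := nk2 _ m2d
  have nk2' := nk2 _ nd
  have nlk2 : l ≠ k2 := fun h => k20 (h ▸ s4 (s3 (s2 l1)))
  have nk12 : k1 ≠ k2 := fun h => k20 (h ▸ k11)
  have le05 : d ≤ d5 := le1.trans (le2.trans (le3.trans (le4.trans le5)))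
  have J5 : ∀ x y, d5.G.inc x y ↔ d.G.inc x y ∨ (y = l ∧ (x = p ∨ x = q)) ∨
      (x = x1 ∧ (y = l ∨ y = m1)) ∨ (x = x2 ∧ (y = l ∨ y = m2)) ∨ (y = k1 ∧ (x = x1 ∨ x = y1)) ∨
      (y = k2 ∧ (x = x2 ∨ x = y2)) := by
    intro x y
    rw [I5, I4, J3]
    clear * -
    tauto
  have lD : Df GM R d5 l := Df.op hM (hp.mono le05) (hq.mono le05) hpq
    (Or.inl ⟨(J5 _ _).2 (by simp), (J5 _ _).2 (by simp)⟩)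
  have x1D : Df GM R d5 x1 := Df.op hM lD (m1D.mono le05) (nl' _ m1d).symm
    (Or.inr ⟨(J5 _ _).2 (by simp), (J5 _ _).2 (by simp)⟩)
  have x2D : Df GM R d5 x2 := Df.op hM lD (m2D.mono le05) (nl' _ m2d).symm
    (Or.inr ⟨(J5 _ _).2 (by simp), (J5 _ _).2 (by simp)⟩)
  have k1D : Df GM R d5 k1 := Df.op hM x1D (y1D.mono le05) (nx1 _ y1d).symm
    (Or.inl ⟨(J5 _ _).2 (by simp), (J5 _ _).2 (by simp)⟩)
  have k2D : Df GM R d5 k2 := Df.op hM x2D (y2D.mono le05) (nx2 _ y2d).symm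
    (Or.inl ⟨(J5 _ _).2 (by simp), (J5 _ _).2 (by simp)⟩)
  have np5 : ¬ d5.G.pt n := by rw [le05.2.pt nd]; exact nl
  have K1 : ∀ z, d5.G.inc z k1 → z = x1 ∨ z = y1 := by
    intro z h
    rw [J5] at h
    clear * - h F4 nlk1 m1k1 m2k1 nk12
    grind
  have K2 : ∀ z, d5.G.inc z k2 → z = x2 ∨ z = y2 := by
    intro z h
    rw [J5] at h
    clear * - h F5 nlk2 m1k2 m2k2 nk12
    grind
  have N : ∀ z, d5.G.inc z n → d.G.inc z n := by
    intro z h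
    rw [J5] at h
    clear * - h nnl' w14 w24 nk1' nk2'
    grind
  refine decide_z hM (fun d' h => hW d' (le05.trans h)) k1D k2D (nD.mono le05)
    (by rwa [pt5 _ k11]) k2p np5 nk12 (nk1 _ nd) (nk2 _ nd) ?_ ?_ ?_
  · intro z h1 h2
    have a1 := K1 z h1
    have a2 := K2 z h2
    clear * - a1 a2 nx12 y2x1 y1x2 ny12
    grind
  · intro z h1 h2
    have a1 := K1 z h1
    have a2 := N z h2
    clear * - a1 a2 F1 y1c
    grind
  · intro z h1 h2
    have a1 := K2 z h1
    have a2 := N z h2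
    clear * - a1 a2 F2 y2c
    grind

theorem no_lines {X M : Type u} [Infinite X] {GM : Geo M} (hM : Plane GM) {R : (M → X) → Prop}
    {d : Cond X} (hW : ∀ d', d ≤ d' → ∃ G f, Wit GM R d' G f) {w : Fin 6 → X}
    {P : Fin 6 → Fin 6 → X} (hH : Hex w P d.G) (hw : ∀ i, Df GM R d (w i))
    (hP : ∀ i j, Df GM R d (P i j)) {p q : X} (hp : Df GM R d p) (hq : Df GM R d q)
    (pp : ¬ d.G.pt p) (pq : ¬ d.G.pt q) (hpq : p ≠ q)
    (hno : ∀ z, d.G.inc z p → d.G.inc z q → False) : False := by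
  obtain ⟨i, j, hij, h1, h2⟩ := hH.pick_point p q
  obtain ⟨d1, x, le1, x0, x1, xp, I1⟩ := d.addPoint {p, q}
    (by rintro x (rfl | rfl); exacts [⟨hp.1, pp⟩, ⟨hq.1, pq⟩])
    (by
      rintro x (rfl | rfl) y (rfl | rfl) hxy z hz hz'
      · exact hxy rfl
      · exact hno z hz hz'
      · exact hno z hz' hz
      · exact hxy rfl)
  simp only [Set.mem_insert_iff, Set.mem_singleton_iff] at I1
  have yp : d.G.pt (P i j) := d.G.inc_pt _ _ ((hH.inc i j i hij).2 (Or.inl rfl))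
  have xy : x ≠ P i j := fun h => x0 (h ▸ (hP i j).1)
  refine no_points hM (fun d' h => hW d' (le1.trans h))
    (hH.map le1.2 (fun i => (hw i).1) (fun i j => (hP i j).1))
    (fun i => (hw i).mono le1) (fun i j => (hP i j).mono le1) (p := x) (q := P i j)
    (Df.op hM (hp.mono le1) (hq.mono le1) hpq (Or.inr ⟨(I1 _ _).2 (by simp), (I1 _ _).2 (by simp)⟩))
    ((hP i j).mono le1) xp (by rwa [le1.2.pt (hP i j).1]) xy ?_
  intro z hz hz'
  rw [I1] at hz hz'
  have := fun h => x0 (d.inc_dom x z h).1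
  grind


theorem prime_finP {M : Type u} {GM : Geo M} (hM : EC GM)
    (hprime : ∀ (X : Type u) (G : Geo X), EC G → ∃ f : M → X, Emb GM G f) : FinP.{u} := by
  classical
  intro A GA hA
  by_contra hcon
  obtain ⟨m0⟩ := hM.nonempty
  obtain ⟨iA, hiA, -⟩ := hM.extend GA Set.univ ∅ (fun _ => m0) Set.finite_univ (by simp)
    ⟨by simp, by simp, by simp⟩ (by simp) (by simp)
  obtain ⟨w, P, hH⟩ := exists_hex hM
  let F : Set M := Set.range iA ∪ Set.range w ∪ Set.range (fun x : Fin 6 × Fin 6 => P x.1 x.2)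
  have hF : F.Finite :=
    ((Set.finite_range _).union (Set.finite_range _)).union (Set.finite_range _)
  haveI := hF.to_subtype
  let X := ULift.{u} ℕ
  let R : (F → X) → (M → X) → Prop := fun a f => ∀ m : F, f m = a m
  obtain ⟨G, hG, hD⟩ := generic (X := X) (J := F → X) (fun a =>
    { carrier := {c | ∀ G f, ¬ Wit GM (R a) c G f}
      isCofinal := by
        intro c0
        obtain ⟨c, hc, hca⟩ := c0.grow (Set.finite_range a).toFinset
        have had : ∀ m, a m ∈ c.dom := fun m => hca (by simp)
        by_contra hno
        have hW : ∀ d, c ≤ d → ∃ G f, Wit GM (R a) d G f := by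
          intro d hd
          by_contra h'
          push Not at h'
          exact hno ⟨d, h', hc.trans hd⟩
        have hDf : ∀ m : F, Df GM (R a) c (a m) := fun m =>
          ⟨had m, m, fun G f hf => hf.2.2.2 m⟩
        obtain ⟨G, f, hf⟩ := hW c le_rfl
        have wF : ∀ i, w i ∈ F := fun i => Or.inl (Or.inr ⟨i, rfl⟩)
        have PF : ∀ i j, P i j ∈ F := fun i j => Or.inr ⟨(i, j), rfl⟩
        have AF : ∀ x, iA x ∈ F := fun x => Or.inl (Or.inl ⟨x, rfl⟩)
        have hfF : ∀ m (hm : m ∈ F), f m = a ⟨m, hm⟩ := fun m hm => hf.2.2.2 ⟨m, hm⟩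
        have hHc : Hex (fun i => a ⟨w i, wF i⟩) (fun i j => a ⟨P i j, PF i j⟩) c.G := by
          have h1 := hH.map hf.2.2.1 (fun _ => trivial) (fun _ _ => trivial)
          refine ⟨fun i j h => h1.inj i j ?_, fun i j k hij => ?_⟩
          · rw [hfF _ (wF i), hfF _ (wF j)]; exact h
          · rw [← h1.inc i j k hij, hfF _ (PF i j), hfF _ (wF k)]
            exact (hf.2.1.inc (had _) (had _)).symm
        -- the finite plane
        let B := {x : X // Df GM (R a) c x}
        apply hcon
        refine ⟨B,
          { pt := fun x => c.G.pt x
            inc := fun x y => c.G.inc x y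
            inc_pt := fun x y => c.G.inc_pt x y
            inc_ln := fun x y => c.G.inc_ln x y
            k22 := fun p q l m a1 a2 a3 a4 => by
              rcases c.G.k22 p q l m a1 a2 a3 a4 with h | h
              · exact Or.inl (Subtype.ext h)
              · exact Or.inr (Subtype.ext h) },
          fun x => ⟨a ⟨iA x, AF x⟩, hDf _⟩, ?_, ⟨?_, ?_⟩, ⟨?_, ?_, ?_⟩⟩
        · exact Finite.of_injective (fun x : B => (⟨x.1, x.2.1⟩ : {x // x ∈ c.dom}))
            (fun x y h => Subtype.ext (congrArg (fun t => t.1) h))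
        · rintro ⟨x, hx⟩ ⟨y, hy⟩ px py hxy
          by_contra hz
          push Not at hz
          have hxy' : x ≠ y := fun h => hxy (Subtype.ext h)
          refine no_points hM.plane hW hHc (fun i => hDf _) (fun i j => hDf _) hx hy px py hxy' ?_
          intro z h1 h2
          exact hz ⟨z, Df.op hM.plane hx hy hxy' (Or.inl ⟨h1, h2⟩)⟩ h1 h2
        · rintro ⟨x, hx⟩ ⟨y, hy⟩ px py hxy
          by_contra hz
          push Not at hz
          have hxy' : x ≠ y := fun h => hxy (Subtype.ext h)
          refine no_lines hM.plane hW hHc (fun i => hDf _) (fun i j => hDf _) hx hy px py hxy' ?_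
          intro z h1 h2
          exact hz ⟨z, Df.op hM.plane hx hy hxy' (Or.inr ⟨h1, h2⟩)⟩ h1 h2
        · intro x _ y _ h
          have h := congrArg Subtype.val h
          simp only at h
          rw [← hfF _ (AF x), ← hfF _ (AF y)] at h
          exact hiA.inj _ trivial _ trivial (hf.2.2.1.inj _ trivial _ trivial h)
        · intro x _
          change c.G.pt (a ⟨iA x, AF x⟩) ↔ _
          rw [← hf.2.1.pt (had _), ← hfF _ (AF x), hf.2.2.1.pt _ trivial, hiA.pt _ trivial]
        · intro x _ y _
          change c.G.inc (a ⟨iA x, AF x⟩) (a ⟨iA y, AF y⟩) ↔ _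
          rw [← hf.2.1.inc (had _) (had _), ← hfF _ (AF x), ← hfF _ (AF y),
            hf.2.2.1.inc _ trivial _ trivial, hiA.inc _ trivial _ trivial] })
  obtain ⟨f, hf⟩ := hprime X G hG
  obtain ⟨c, hc1, hc2⟩ := hD (fun m => f m)
  exact hc1 G f ⟨hG.plane, hc2, hf, fun m => rfl⟩

theorem finP_iff : FinP.{u} ↔ (∀ (A : Type u) (_ : IncLang.Structure A),
      Finite A → IsIncidenceL A → KFreeL 2 2 A →
        ∃ (B : Type u) (_ : IncLang.Structure B), Finite B ∧ IsProjPlaneL B ∧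
          Nonempty (A ↪[IncLang] B)) := by
  constructor
  · intro h A _ hA h1 h2
    obtain ⟨B, H, f, hB, hH, hf⟩ := h A (toGeo h1 h2) hA
    letI := ofGeo H
    refine ⟨B, ofGeo H, hB, ⟨ofGeo_inci H, ofGeo_kfree H, ?_, ?_⟩,
      ⟨mkEmb h1 (ofGeo_inci H) f (fun x y e => hf.inj _ trivial _ trivial e)
        (fun x => hf.pt x trivial) (fun x y => hf.inc x trivial y trivial)⟩⟩
    · intro x y hx hy hxy
      obtain ⟨z, hz⟩ := hH.1 x y hx hy hxy
      refine ⟨z, hz, fun z' hz' => ?_⟩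
      rcases H.k22 x y z' z hz'.1 hz'.2 hz.1 hz.2 with e | e
      · exact absurd e hxy
      · exact e
    · intro x y hx hy hxy
      obtain ⟨z, hz⟩ := hH.2 x y hx hy hxy
      refine ⟨z, hz, fun z' hz' => ?_⟩
      rcases H.k22 z' z x y hz'.1 hz.1 hz'.2 hz.2 with e | e
      · exact e
      · exact absurd e hxy
  · intro h A GA hA
    letI := ofGeo GA
    obtain ⟨B, _, hB, hP, ⟨f⟩⟩ := h A (ofGeo GA) hA (ofGeo_inci GA) (ofGeo_kfree GA)
    refine ⟨B, toGeo hP.1 hP.2.1, f, hB, ⟨?_, ?_⟩,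
      emb_Emb f (ofGeo_inci GA) (ofGeo_kfree GA) hP.1 hP.2.1⟩
    · intro x y hx hy hxy
      obtain ⟨z, hz, -⟩ := hP.2.2.1 x y hx hy hxy
      exact ⟨z, hz⟩
    · intro x y hx hy hxy
      obtain ⟨z, hz, -⟩ := hP.2.2.2 x y ((ln_iff hP.1 x).2 hx) ((ln_iff hP.1 y).2 hy) hxy
      exact ⟨z, hz⟩

/-- The theory of existentially closed `K_{2,2}`-free incidence structures has a prime
model (an existentially closed structure elementarily embedding into every existentially
closed structure) if and only if every finite partial plane embeds as an induced
substructure into a finite projective plane. -/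
theorem statement_13 :
    (∃ (M : Type u) (_ : IncLang.Structure M), IsECL 2 2 M ∧
      ∀ (N : Type u) (_ : IncLang.Structure N), IsECL 2 2 N →
        Nonempty (M ↪ₑ[IncLang] N)) ↔
    (∀ (A : Type u) (_ : IncLang.Structure A),
      Finite A → IsIncidenceL A → KFreeL 2 2 A →
        ∃ (B : Type u) (_ : IncLang.Structure B), Finite B ∧ IsProjPlaneL B ∧
          Nonempty (A ↪[IncLang] B)) := by
  rw [← finP_iff.{u}]
  constructor
  · rintro ⟨M, _, hM, h⟩
    refine prime_finP hM.ec (fun X G hG => ?_)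
    letI := ofGeo G
    obtain ⟨f⟩ := h X (ofGeo G) hG.isECL
    exact ⟨f, emb_Emb f.toEmbedding hM.1 hM.2.1 (ofGeo_inci G) (ofGeo_kfree G)⟩
  · intro h
    obtain ⟨G, hG, hp⟩ := h.prime (X := ULift.{u} ℕ)
    letI := ofGeo G
    refine ⟨ULift.{u} ℕ, ofGeo G, hG.isECL, fun N _ hN => ?_⟩
    obtain ⟨f, hf⟩ := hp N (toGeo hN.1 hN.2.1) hN.ec
    exact elem_of_emb hG.isECL hN f hf
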